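/- arXiv:2212.00598 — 4 statements merged into one kernel-verified Lean document; each statement's English description precedes it below -/
import Mathlib

section
/- Let b ∈ ℝ[x₁,…,xₙ] be a polynomial, let f = (f₁,…,fₙ) be a vector of polynomials and g = (g_{ij}) an n×m matrix of polynomials, and let K = {x ∈ ℝⁿ : b(x) = 0 and (L_g b)_j(x) = 0 for all j = 1,…,m}. Suppose there exist a natural number a ≥ 0, DSOS polynomials s₁, s₂, and polynomials p₁₀, p₂₀, p₁ⱼ, p₂ⱼ ∈ ℝ[x₁,…,xₙ] (j = 1,…,m) such that the polynomial identity (s₁ + b·p₁₀ + Σ_{j=1}^m (L_g b)_j·p₁ⱼ)·(L_f b) − s₂ − b·p₂₀ − Σ_{j=1}^m (L_g b)_j·p₂ⱼ − (L_f b)^{2a} = 0 holds. Then L_f b(x) ≥ 0 for every x ∈ K. -/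
/-- A polynomial is a monomial (with coefficient 1). -/
def IsMonomialPoly {n : ℕ} (p : MvPolynomial (Fin n) ℝ) : Prop :=
  ∃ d : Fin n →₀ ℕ, p = MvPolynomial.monomial d 1

/-- A polynomial is a diagonally dominant sum of squares (DSOS):
`s = ∑ aᵢ mᵢ² + ∑ b_{ij} (mᵢ + mⱼ)² + ∑ c_{ij} (mᵢ - mⱼ)²` for monomials `mᵢ`
and nonnegative scalars `aᵢ, b_{ij}, c_{ij}`. -/
def IsDSOS {n : ℕ} (s : MvPolynomial (Fin n) ℝ) : Prop :=
  ∃ (k : ℕ) (mono : Fin k → MvPolynomial (Fin n) ℝ)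
    (a : Fin k → ℝ) (bc cc : Fin k → Fin k → ℝ),
    (∀ i, IsMonomialPoly (mono i)) ∧
    (∀ i, 0 ≤ a i) ∧ (∀ i j, 0 ≤ bc i j) ∧ (∀ i j, 0 ≤ cc i j) ∧
    s = (∑ i, MvPolynomial.C (a i) * (mono i) ^ 2)
        + (∑ i, ∑ j, MvPolynomial.C (bc i j) * (mono i + mono j) ^ 2)
        + (∑ i, ∑ j, MvPolynomial.C (cc i j) * (mono i - mono j) ^ 2)

/-- The Lie derivative `L_f b = ∑ i (∂b/∂xᵢ) fᵢ`. -/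
noncomputable def LieF {n : ℕ} (f : Fin n → MvPolynomial (Fin n) ℝ)
    (b : MvPolynomial (Fin n) ℝ) : MvPolynomial (Fin n) ℝ :=
  ∑ i, MvPolynomial.pderiv i b * f i

/-- The `j`-th component of the Lie derivative `(L_g b)_j = ∑ i (∂b/∂xᵢ) g_{ij}`. -/
noncomputable def LieG {n m : ℕ} (g : Fin n → Fin m → MvPolynomial (Fin n) ℝ)
    (b : MvPolynomial (Fin n) ℝ) (j : Fin m) : MvPolynomial (Fin n) ℝ :=
  ∑ i, MvPolynomial.pderiv i b * g i j

theorem IsDSOS.eval_nonneg' {n : ℕ} {s : MvPolynomial (Fin n) ℝ} (hs : IsDSOS s)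
    (x : Fin n → ℝ) : 0 ≤ MvPolynomial.eval x s := by
  obtain ⟨k, mono, a, bc, cc, -, ha, hb, hc, rfl⟩ := hs
  simp only [map_add, map_sum, map_mul, map_pow, map_sub, MvPolynomial.eval_C]
  refine add_nonneg (add_nonneg ?_ ?_) ?_
  · exact Finset.sum_nonneg fun i _ => mul_nonneg (ha i) (sq_nonneg _)
  · exact Finset.sum_nonneg fun i _ => Finset.sum_nonneg fun j _ =>
      mul_nonneg (hb i j) (sq_nonneg _)
  · exact Finset.sum_nonneg fun i _ => Finset.sum_nonneg fun j _ =>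
      mul_nonneg (hc i j) (sq_nonneg _)

/-- Theorem 3: if a DSOS Positivstellensatz certificate exists, then `L_f b ≥ 0`
on `K = {x : b(x) = 0, (L_g b)_j(x) = 0 ∀ j}`, i.e. `b` is a verified CBF. -/
theorem single_cbf_dsos_certificate_implies_nonneg {n m : ℕ}
    (b : MvPolynomial (Fin n) ℝ)
    (f : Fin n → MvPolynomial (Fin n) ℝ)
    (g : Fin n → Fin m → MvPolynomial (Fin n) ℝ)
    (a : ℕ) (s₁ s₂ p₁₀ p₂₀ : MvPolynomial (Fin n) ℝ)
    (p₁ p₂ : Fin m → MvPolynomial (Fin n) ℝ)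
    (hs₁ : IsDSOS s₁) (hs₂ : IsDSOS s₂)
    (hcert : (s₁ + b * p₁₀ + ∑ j, LieG g b j * p₁ j) * LieF f b
        - s₂ - b * p₂₀ - (∑ j, LieG g b j * p₂ j)
        - (LieF f b) ^ (2 * a) = 0) :
    ∀ x : Fin n → ℝ,
      (MvPolynomial.eval x b = 0 ∧ ∀ j : Fin m, MvPolynomial.eval x (LieG g b j) = 0) →
      0 ≤ MvPolynomial.eval x (LieF f b) := by
  rintro x ⟨hb, hg⟩
  by_contra! hneg
  have h := congrArg (MvPolynomial.eval x) hcert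
  simp only [map_add, map_sum, map_mul, map_pow, map_sub, map_zero, hb, hg, zero_mul,
    Finset.sum_const_zero, add_zero, sub_zero] at h
  have h1 := hs₁.eval_nonneg' x
  have h2 := hs₂.eval_nonneg' x
  have h3 : 0 < (MvPolynomial.eval x (LieF f b)) ^ (2 * a) :=
    (even_two_mul a).pow_pos hneg.ne
  have h4 := mul_nonpos_of_nonneg_of_nonpos h1 hneg.le
  linarith
end

section
/- Every polynomial p ∈ ℝ[x₁,…,xₙ] can be written as p = d₁ − d₂, where d₁ and d₂ are DSOS polynomials. -/
theorem isDSOS_add_aux {n : ℕ} {s t : MvPolynomial (Fin n) ℝ} (hs : IsDSOS s) (ht : IsDSOS t) :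
    IsDSOS (s + t) := by
  obtain ⟨k, m, a, b, c, hm, ha, hb, hc, rfl⟩ := hs
  obtain ⟨k', m', a', b', c', hm', ha', hb', hc', rfl⟩ := ht
  refine ⟨k + k', Fin.append m m', Fin.append a a',
    Fin.append (fun i => Fin.append (b i) (fun _ => 0)) (fun i => Fin.append (fun _ => 0) (b' i)),
    Fin.append (fun i => Fin.append (c i) (fun _ => 0)) (fun i => Fin.append (fun _ => 0) (c' i)),
    ?_, ?_, ?_, ?_, ?_⟩
  · intro i
    refine Fin.addCases (fun i => ?_) (fun i => ?_) i <;> simp [hm, hm']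
  · intro i
    refine Fin.addCases (fun i => ?_) (fun i => ?_) i <;> simp [ha, ha']
  · intro i j
    refine Fin.addCases (fun i => ?_) (fun i => ?_) i <;>
    refine Fin.addCases (fun j => ?_) (fun j => ?_) j <;> simp [hb, hb']
  · intro i j
    refine Fin.addCases (fun i => ?_) (fun i => ?_) i <;>
    refine Fin.addCases (fun j => ?_) (fun j => ?_) j <;> simp [hc, hc']
  · simp only [Fin.sum_univ_add, Fin.append_left, Fin.append_right, map_zero, zero_mul,
      Finset.sum_const_zero, add_zero, zero_add]
    abel

theorem isDSOS_pair_aux {n : ℕ} (d : Fin n →₀ ℕ) (x y : ℝ) (hx : 0 ≤ x) (hy : 0 ≤ y) :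
    IsDSOS (MvPolynomial.C x * (MvPolynomial.monomial d 1 + 1) ^ 2
      + MvPolynomial.C y * (MvPolynomial.monomial d 1 - 1) ^ 2) := by
  refine ⟨2, ![MvPolynomial.monomial d 1, 1], ![0, 0], ![![0, x], ![0, 0]], ![![0, y], ![0, 0]],
    ?_, ?_, ?_, ?_, ?_⟩
  · intro i
    fin_cases i
    · exact ⟨d, rfl⟩
    · exact ⟨0, rfl⟩
  · intro i
    fin_cases i <;> simp
  · intro i j
    fin_cases i <;> fin_cases j <;> simp [hx]
  · intro i j
    fin_cases i <;> fin_cases j <;> simp [hy]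
  · simp [Fin.sum_univ_two]

/-- Every polynomial is a difference of two DSOS polynomials. -/
theorem dsos_difference {n : ℕ} (p : MvPolynomial (Fin n) ℝ) :
    ∃ d₁ d₂ : MvPolynomial (Fin n) ℝ, IsDSOS d₁ ∧ IsDSOS d₂ ∧ p = d₁ - d₂ := by
  induction p using MvPolynomial.induction_on' with
  | monomial d c =>
    have key : MvPolynomial.monomial d c
        = MvPolynomial.C (4 * (c / 4)) * MvPolynomial.monomial d (1 : ℝ) := by
      rw [MvPolynomial.C_mul_monomial]; congr 1; ring
    refine ⟨_, _, isDSOS_pair_aux d (max (c / 4) 0) (max (-(c / 4)) 0) (le_max_right _ _)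
      (le_max_right _ _), isDSOS_pair_aux d (max (-(c / 4)) 0) (max (c / 4) 0) (le_max_right _ _)
      (le_max_right _ _), ?_⟩
    have h : c / 4 = max (c / 4) 0 - max (-(c / 4)) 0 := by
      rcases le_total 0 (c / 4) with h | h
      · rw [max_eq_left h, max_eq_right (by linarith)]; ring
      · rw [max_eq_right h, max_eq_left (by linarith)]; ring
    rw [key]
    generalize max (c / 4) 0 = u at *
    generalize max (-(c / 4)) 0 = v at *
    rw [h, map_mul, map_sub, show (MvPolynomial.C (4 : ℝ) : MvPolynomial (Fin n) ℝ) = 4 from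
      map_ofNat _ 4]
    ring
  | add p q hp hq =>
    obtain ⟨a, b, ha, hb, rfl⟩ := hp
    obtain ⟨a', b', ha', hb', rfl⟩ := hq
    exact ⟨a + a', b + b', isDSOS_add_aux ha ha', isDSOS_add_aux hb hb', by ring⟩
end

section
/- Let s ∈ ℝ[x₁,…,xₙ] be a polynomial of degree at most 2d, and let m(x) be the vector of all monomials in x₁,…,xₙ of degree at most d (of length k = C(n+d, n)). Then s is a DSOS polynomial if and only if there exists a symmetric matrix Q ∈ ℝ^{k×k} such that s(x) = m(x)ᵀ Q m(x) for all x and Q is diagonally dominant, i.e. Q_{ii} ≥ Σ_{j≠i} |Q_{ij}| for every i = 1,…,k. -/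
open MvPolynomial in
lemma aux_coeff {n : ℕ} (y : Fin n → ℝ) (e : ℕ) (p : MvPolynomial (Fin n) ℝ) :
    (aeval (fun i => Polynomial.C (y i) * Polynomial.X) p : Polynomial ℝ).coeff e
      = eval y (homogeneousComponent e p) := by
  induction p using MvPolynomial.induction_on' with
  | add p q hp hq => simp [hp, hq]
  | monomial σ a =>
    have h1 : (aeval (fun i => Polynomial.C (y i) * Polynomial.X) (monomial σ a) : Polynomial ℝ)
        = Polynomial.C (a * ∏ i, y i ^ σ i) * Polynomial.X ^ (∑ i, σ i) := by
      rw [aeval_monomial, Finsupp.prod_fintype _ _ (by simp)]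
      simp only [mul_pow, Finset.prod_mul_distrib, Finset.prod_pow_eq_pow_sum]
      simp [Polynomial.algebraMap_eq, mul_assoc]
    have hd : Finsupp.degree σ = ∑ i, σ i := Finsupp.degree_eq_sum σ
    rw [h1, Polynomial.coeff_C_mul, Polynomial.coeff_X_pow]
    by_cases h : e = ∑ i, σ i
    · rw [homogeneousComponent_of_mem (m := e) (n := ∑ i, σ i) (isHomogeneous_monomial a hd)]
      simp [h, eval_monomial, Finsupp.prod_fintype]
    · rw [homogeneousComponent_of_mem (m := e) (n := ∑ i, σ i) (isHomogeneous_monomial a hd)]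
      simp [h]

open MvPolynomial in
lemma aux_eval {n : ℕ} (y : Fin n → ℝ) (t : ℝ) (p : MvPolynomial (Fin n) ℝ) :
    (aeval (fun i => Polynomial.C (y i) * Polynomial.X) p : Polynomial ℝ).eval t
      = eval (fun i => y i * t) p := by
  induction p using MvPolynomial.induction_on with
  | C a => simp [Polynomial.algebraMap_eq]
  | add p q hp hq => simp [hp, hq]
  | mul_X p i hp => simp [hp]

open MvPolynomial in
lemma aux_degree {n d : ℕ} (s p : MvPolynomial (Fin n) ℝ) (hdeg : s.totalDegree ≤ 2 * d)
    (w : ℝ) (hw : 0 < w) (h : ∀ x, w * (eval x p) ^ 2 ≤ eval x s) : p.totalDegree ≤ d := by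
  by_contra hcon
  push Not at hcon
  have hp0 : p ≠ 0 := by
    rintro rfl
    simp at hcon
  have hne : homogeneousComponent p.totalDegree p ≠ 0 := by
    obtain ⟨σ, hσ, hd⟩ := Finset.exists_mem_eq_sup p.support (by simpa using hp0)
      (fun m => Finsupp.degree m)
    have hdeg' : p.totalDegree = Finsupp.degree σ := by
      rw [← hd]
      rfl
    intro h0
    have := congrArg (coeff σ) h0
    rw [coeff_homogeneousComponent, if_pos hdeg'.symm] at this
    exact (mem_support_iff.mp hσ) (by simpa using this)
  obtain ⟨y, hy⟩ : ∃ y, eval y (homogeneousComponent p.totalDegree p) ≠ 0 := by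
    by_contra hall
    push Not at hall
    exact hne (MvPolynomial.funext (by simpa using hall))
  set q : Polynomial ℝ := aeval (fun i => Polynomial.C (y i) * Polynomial.X) p with hq
  set f : Polynomial ℝ := aeval (fun i => Polynomial.C (y i) * Polynomial.X) s with hf
  have hqc : q.coeff p.totalDegree ≠ 0 := by rw [hq, aux_coeff]; exact hy
  have hq0 : q ≠ 0 := by rintro h0; simp [h0] at hqc
  have hqd : d < q.natDegree := lt_of_lt_of_le hcon (Polynomial.le_natDegree_of_ne_zero hqc)
  have hfd : f.natDegree ≤ 2 * d := by
    rw [Polynomial.natDegree_le_iff_coeff_eq_zero]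
    intro N hN
    rw [hf, aux_coeff, homogeneousComponent_eq_zero _ _ (by omega)]
    simp
  have hlt : f.degree < (q ^ 2).degree := by
    apply Polynomial.degree_lt_degree
    rw [Polynomial.natDegree_pow]
    omega
  have ht := Polynomial.div_tendsto_atTop_zero_of_degree_lt f (q ^ 2) hlt
  have hev : ∀ᶠ t in Filter.atTop, w ≤ f.eval t / (q ^ 2).eval t := by
    have hnr := Polynomial.eventually_atTop_not_isRoot q hq0
    filter_upwards [hnr] with t htr
    have hqt : q.eval t ≠ 0 := htr
    rw [le_div_iff₀ (by rw [Polynomial.eval_pow]; positivity)]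
    rw [Polynomial.eval_pow, hq, hf, aux_eval, aux_eval]
    exact h _
  have := ge_of_tendsto ht hev
  linarith

def HasGram {n k : ℕ} (mono : Fin k → (Fin n →₀ ℕ)) (s : MvPolynomial (Fin n) ℝ) : Prop :=
  ∃ Q : Matrix (Fin k) (Fin k) ℝ,
        Q.IsSymm ∧
        (∀ x : Fin n → ℝ,
          MvPolynomial.eval x s =
            ∑ i, ∑ j, Q i j * MvPolynomial.eval x (MvPolynomial.monomial (mono i) (1 : ℝ))
              * MvPolynomial.eval x (MvPolynomial.monomial (mono j) (1 : ℝ))) ∧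
        (∀ i : Fin k, ∑ j ∈ Finset.univ.erase i, |Q i j| ≤ Q i i)

lemma HasGram.zero {n k : ℕ} (mono : Fin k → (Fin n →₀ ℕ)) : HasGram mono 0 :=
  ⟨0, by simp [Matrix.IsSymm], by simp, by simp⟩

lemma HasGram.add {n k : ℕ} {mono : Fin k → (Fin n →₀ ℕ)} {s t : MvPolynomial (Fin n) ℝ}
    (hs : HasGram mono s) (ht : HasGram mono t) : HasGram mono (s + t) := by
  obtain ⟨Q, h1, h2, h3⟩ := hs
  obtain ⟨R, g1, g2, g3⟩ := ht
  refine ⟨Q + R, h1.add g1, fun x => ?_, fun i => ?_⟩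
  · rw [map_add, h2, g2]
    simp only [Matrix.add_apply, add_mul, Finset.sum_add_distrib]
  · calc _ ≤ ∑ j ∈ Finset.univ.erase i, (|Q i j| + |R i j|) :=
          Finset.sum_le_sum fun j _ => abs_add_le _ _
      _ ≤ _ := by rw [Finset.sum_add_distrib]; exact add_le_add (h3 i) (g3 i)

lemma HasGram.sum {n k : ℕ} {mono : Fin k → (Fin n →₀ ℕ)} {ι : Type*} (S : Finset ι)
    (f : ι → MvPolynomial (Fin n) ℝ) (h : ∀ i, HasGram mono (f i)) :
    HasGram mono (∑ i ∈ S, f i) :=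
  Finset.sum_induction f (HasGram mono) (fun _ _ => HasGram.add) (HasGram.zero mono)
    (fun i _ => h i)

open MvPolynomial in
lemma HasGram.sq {n k : ℕ} {mono : Fin k → (Fin n →₀ ℕ)} (w : ℝ) (hw : 0 ≤ w) (ε : ℝ)
    (hε : ε = 1 ∨ ε = -1) (i j : Fin k) :
    HasGram mono (C w * (monomial (mono i) 1 + C ε * monomial (mono j) 1) ^ 2) := by
  set v : Fin k → ℝ := fun a => (if a = i then 1 else 0) + ε * (if a = j then 1 else 0) with hv
  refine ⟨fun a b => w * (v a * v b), ?_, fun x => ?_, fun a => ?_⟩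
  · ext a b
    change w * (v b * v a) = w * (v a * v b)
    ring
  · have : ∀ m : Fin k → ℝ, ∑ a, v a * m a = m i + ε * m j := by
      intro m
      simp [hv, add_mul, Finset.sum_add_distrib, mul_assoc, ← Finset.mul_sum]
    simp only [map_mul, map_pow, map_add, eval_C]
    rw [← this (fun a => eval x (monomial (mono a) 1)), _root_.sq, Finset.sum_mul_sum, Finset.mul_sum]
    refine Finset.sum_congr rfl fun a _ => ?_
    rw [Finset.mul_sum]
    exact Finset.sum_congr rfl fun b _ => by ring
  · have h1 : ∑ b, |v b| ≤ 2 := by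
      calc _ ≤ ∑ b : Fin k, ((if b = i then (1 : ℝ) else 0) + (if b = j then 1 else 0)) := by
            refine Finset.sum_le_sum fun b _ => ?_
            simp only [hv]
            rcases hε with rfl | rfl <;> split_ifs <;> norm_num
        _ = 2 := by simp [Finset.sum_add_distrib]; norm_num
    have h2 : |v a| ≤ |v a| * |v a| := by
      simp only [hv]
      rcases hε with rfl | rfl <;> split_ifs <;> norm_num
    have h3 := Finset.add_sum_erase Finset.univ (fun b => |v b|) (Finset.mem_univ a)
    simp only [abs_mul, abs_of_nonneg hw, ← Finset.mul_sum]
    refine mul_le_mul_of_nonneg_left ?_ hw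
    rw [← abs_mul_abs_self (v a)]
    nlinarith [abs_nonneg (v a)]

open MvPolynomial in
lemma HasGram.term {n d k : ℕ} {mono : Fin k → (Fin n →₀ ℕ)}
    (hall : ∀ σ : Fin n →₀ ℕ, (∑ i, σ i) ≤ d → ∃ i : Fin k, mono i = σ)
    (s : MvPolynomial (Fin n) ℝ) (hdeg : s.totalDegree ≤ 2 * d) (w : ℝ) (hw : 0 ≤ w) (ε : ℝ)
    (hε : ε = 1 ∨ ε = -1) (p q : MvPolynomial (Fin n) ℝ) (hp : IsMonomialPoly p)
    (hq : IsMonomialPoly q) (h : ∀ x, w * (eval x (p + C ε * q)) ^ 2 ≤ eval x s) :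
    HasGram mono (C w * (p + C ε * q) ^ 2) := by
  obtain ⟨σ, rfl⟩ := hp
  obtain ⟨τ, rfl⟩ := hq
  rcases hw.eq_or_lt with rfl | hw'
  · simpa using HasGram.zero mono
  have hd := aux_degree s _ hdeg w hw' h
  by_cases hz : σ = τ ∧ ε = -1
  · obtain ⟨rfl, rfl⟩ := hz
    simpa using HasGram.zero mono
  have key : ∀ ρ : Fin n →₀ ℕ, coeff ρ (monomial σ 1 + C ε * monomial τ (1 : ℝ)) ≠ 0 →
      ∑ i, ρ i ≤ d := by
    intro ρ hρ
    by_contra hc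
    apply hρ
    apply coeff_eq_zero_of_totalDegree_lt
    change _ < Finsupp.degree ρ
    rw [Finsupp.degree_eq_sum]
    omega
  obtain ⟨i, rfl⟩ := hall σ (key σ (by
    simp only [coeff_add, coeff_C_mul, coeff_monomial]
    rcases hε with rfl | rfl <;> by_cases hh : σ = τ <;> simp_all [eq_comm] <;> norm_num))
  obtain ⟨j, rfl⟩ := hall τ (key τ (by
    simp only [coeff_add, coeff_C_mul, coeff_monomial]
    rcases hε with rfl | rfl <;> by_cases hh : mono i = τ <;> simp_all [eq_comm] <;> norm_num))
  exact HasGram.sq w hw ε hε i j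

/-- Proposition 5: a polynomial `s` of degree at most `2d` is DSOS iff there is a
symmetric diagonally dominant Gram matrix `Q` (indexed by the `k = C(n+d,n)`
monomials `m` of degree at most `d`) with `s(x) = m(x)ᵀ Q m(x)` for all `x`. -/
theorem dsos_iff_diagonally_dominant_gram {n d : ℕ}
    (s : MvPolynomial (Fin n) ℝ) (hdeg : s.totalDegree ≤ 2 * d)
    (k : ℕ) (hk : k = (n + d).choose n)
    (mono : Fin k → (Fin n →₀ ℕ))
    -- `mono` enumerates exactly the monomial exponents of degree at most `d`
    (hmono_inj : Function.Injective mono)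
    (hmono_all : ∀ σ : Fin n →₀ ℕ, (∑ i, σ i) ≤ d ↔ ∃ i : Fin k, mono i = σ) :
    IsDSOS s ↔
      ∃ Q : Matrix (Fin k) (Fin k) ℝ,
        Q.IsSymm ∧
        (∀ x : Fin n → ℝ,
          MvPolynomial.eval x s =
            ∑ i, ∑ j, Q i j * MvPolynomial.eval x (MvPolynomial.monomial (mono i) (1 : ℝ))
              * MvPolynomial.eval x (MvPolynomial.monomial (mono j) (1 : ℝ))) ∧
        (∀ i : Fin k, ∑ j ∈ Finset.univ.erase i, |Q i j| ≤ Q i i) := by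
  constructor
  · rintro ⟨K, m, a, b, c, hm, ha, hb, hc, hs⟩
    change HasGram mono s
    have hA : ∀ x i, 0 ≤ a i * (MvPolynomial.eval x (m i)) ^ 2 := fun x i => mul_nonneg (ha i) (sq_nonneg _)
    have hB : ∀ x i j, 0 ≤ b i j * (MvPolynomial.eval x (m i) + MvPolynomial.eval x (m j)) ^ 2 :=
      fun x i j => mul_nonneg (hb i j) (sq_nonneg _)
    have hC : ∀ x i j, 0 ≤ c i j * (MvPolynomial.eval x (m i) - MvPolynomial.eval x (m j)) ^ 2 :=
      fun x i j => mul_nonneg (hc i j) (sq_nonneg _)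
    have hev : ∀ x, MvPolynomial.eval x s = (∑ i, a i * (MvPolynomial.eval x (m i)) ^ 2)
        + (∑ i, ∑ j, b i j * (MvPolynomial.eval x (m i) + MvPolynomial.eval x (m j)) ^ 2)
        + (∑ i, ∑ j, c i j * (MvPolynomial.eval x (m i) - MvPolynomial.eval x (m j)) ^ 2) := by
      intro x
      conv_lhs => rw [hs]
      simp
    have hSA : ∀ x, 0 ≤ ∑ i, a i * (MvPolynomial.eval x (m i)) ^ 2 :=
      fun x => Finset.sum_nonneg fun i _ => hA x i
    have hSB : ∀ x, 0 ≤ ∑ i, ∑ j, b i j * (MvPolynomial.eval x (m i) + MvPolynomial.eval x (m j)) ^ 2 :=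
      fun x => Finset.sum_nonneg fun i _ => Finset.sum_nonneg fun j _ => hB x i j
    have hSC : ∀ x, 0 ≤ ∑ i, ∑ j, c i j * (MvPolynomial.eval x (m i) - MvPolynomial.eval x (m j)) ^ 2 :=
      fun x => Finset.sum_nonneg fun i _ => Finset.sum_nonneg fun j _ => hC x i j
    have hall := fun σ => (hmono_all σ).1
    rw [hs]
    refine ((HasGram.sum _ _ fun i => ?_).add (HasGram.sum _ _ fun i => HasGram.sum _ _ fun j => ?_)).add
      (HasGram.sum _ _ fun i => HasGram.sum _ _ fun j => ?_)
    · have := HasGram.term hall s hdeg (a i / 4) (by linarith [ha i]) 1 (Or.inl rfl) (m i) (m i)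
        (hm i) (hm i) (fun x => by
          have h1 := Finset.single_le_sum (fun i _ => hA x i) (Finset.mem_univ i)
          rw [hev x]
          simp only [map_add, map_mul, MvPolynomial.eval_C]
          nlinarith [hSB x, hSC x])
      convert this using 1
      have h4 : (MvPolynomial.C (a i) : MvPolynomial (Fin n) ℝ) = MvPolynomial.C (a i / 4) * 4 := by
        rw [show (4 : MvPolynomial (Fin n) ℝ) = MvPolynomial.C 4 from (map_ofNat MvPolynomial.C 4).symm, ← MvPolynomial.C_mul]
        congr 1
        ring
      rw [h4, MvPolynomial.C_1]
      ring
    · have := HasGram.term hall s hdeg (b i j) (hb i j) 1 (Or.inl rfl) (m i) (m j)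
        (hm i) (hm j) (fun x => by
          have h1 := Finset.single_le_sum (fun j _ => hB x i j) (Finset.mem_univ j)
          have h2 := Finset.single_le_sum
            (fun i _ => Finset.sum_nonneg fun j (_ : j ∈ Finset.univ) => hB x i j)
            (Finset.mem_univ i)
          rw [hev x]
          simp only [map_add, map_mul, MvPolynomial.eval_C, one_mul]
          linarith [hSA x, hSC x])
      simpa using this
    · have := HasGram.term hall s hdeg (c i j) (hc i j) (-1) (Or.inr rfl) (m i) (m j)
        (hm i) (hm j) (fun x => by
          have h1 := Finset.single_le_sum (fun j _ => hC x i j) (Finset.mem_univ j)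
          have h2 := Finset.single_le_sum
            (fun i _ => Finset.sum_nonneg fun j (_ : j ∈ Finset.univ) => hC x i j)
            (Finset.mem_univ i)
          rw [hev x]
          simp only [map_add, map_mul, MvPolynomial.eval_C, neg_one_mul, ← sub_eq_add_neg]
          linarith [hSA x, hSB x])
      simpa [← sub_eq_add_neg] using this
  · rintro ⟨Q, hQ, hs, hdd⟩
    set R : Fin k → Fin k → ℝ := fun i j => if i = j then 0 else Q i j with hR
    have hRs : ∀ i j, R i j = R j i := by
      intro i j
      simp only [hR, eq_comm (a := i), hQ.apply j i]
    have hRsum : ∀ i, ∑ j, |R i j| = ∑ j ∈ Finset.univ.erase i, |Q i j| := by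
      intro i
      rw [← Finset.add_sum_erase Finset.univ (fun j => |R i j|) (Finset.mem_univ i)]
      simp only [hR, if_true, abs_zero, zero_add]
      refine Finset.sum_congr rfl fun j hj => ?_
      rw [if_neg (Finset.ne_of_mem_erase hj).symm]
    refine ⟨k, fun i => MvPolynomial.monomial (mono i) 1, fun i => Q i i - ∑ j, |R i j|,
      fun i j => (|R i j| + R i j) / 4, fun i j => (|R i j| - R i j) / 4,
      fun i => ⟨_, rfl⟩, fun i => ?_, fun i j => ?_, fun i j => ?_, ?_⟩
    · change 0 ≤ Q i i - ∑ j, |R i j|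
      rw [hRsum]
      linarith [hdd i]
    · linarith [neg_abs_le (R i j)]
    · linarith [le_abs_self (R i j)]
    · apply MvPolynomial.funext
      intro x
      rw [hs x]
      simp only [map_add, map_sum, map_mul, map_pow, map_sub, MvPolynomial.eval_C]
      generalize hM : (fun i => MvPolynomial.eval x (MvPolynomial.monomial (mono i) (1 : ℝ))) = M
      have hM' : ∀ i, MvPolynomial.eval x (MvPolynomial.monomial (mono i) (1 : ℝ)) = M i := fun i => by rw [← hM]
      simp only [hM']
      have e1 : ∑ i, ∑ j, Q i j * M i * M j
          = ∑ i, Q i i * M i ^ 2 + ∑ i, ∑ j, R i j * M i * M j := by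
        rw [← Finset.sum_add_distrib]
        refine Finset.sum_congr rfl fun i _ => ?_
        have : ∀ j, Q i j * M i * M j
            = (if i = j then Q i i * M i ^ 2 else 0) + R i j * M i * M j := by
          intro j
          by_cases h : i = j
          · subst h
            simp only [hR, if_true]
            ring
          · simp [hR, h]
        rw [Finset.sum_congr rfl fun j _ => this j, Finset.sum_add_distrib]
        simp
      have e2 : ∑ i, ∑ j, |R i j| * M j ^ 2 = ∑ i, ∑ j, |R i j| * M i ^ 2 := by
        rw [Finset.sum_comm]
        refine Finset.sum_congr rfl fun i _ => Finset.sum_congr rfl fun j _ => ?_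
        rw [hRs]
      have e3 : (∑ i, ∑ j, (|R i j| + R i j) / 4 * (M i + M j) ^ 2)
          + ∑ i, ∑ j, (|R i j| - R i j) / 4 * (M i - M j) ^ 2
          = (∑ i, ∑ j, |R i j| * M i ^ 2) / 2 + (∑ i, ∑ j, |R i j| * M j ^ 2) / 2
            + ∑ i, ∑ j, R i j * M i * M j := by
        simp only [Finset.sum_div, ← Finset.sum_add_distrib]
        refine Finset.sum_congr rfl fun i _ => Finset.sum_congr rfl fun j _ => ?_
        ring
      have e4 : ∑ i, (Q i i - ∑ j, |R i j|) * M i ^ 2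
          = ∑ i, Q i i * M i ^ 2 - ∑ i, ∑ j, |R i j| * M i ^ 2 := by
        simp only [sub_mul, Finset.sum_sub_distrib, Finset.sum_mul]
      rw [add_assoc, e3, e4, e1, e2]
      ring
end

section
/- Let f₁,…,f_r, g₁,…,g_s ∈ ℝ[x₁,…,xₙ], let K = {x ∈ ℝⁿ : fᵢ(x) ≥ 0 for i = 1,…,r and gⱼ(x) = 0 for j = 1,…,s}, and let P_S be the associated preorder. For q ∈ ℝ[x₁,…,xₙ], q(x) ≥ 0 for all x ∈ K if and only if there exist an integer m ≥ 0 and h₁, h₂ ∈ P_S such that h₁·q = q^{2m} + h₂ as polynomials. -/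
/-- A polynomial is a sum of squares. -/
def IsSOS {n : ℕ} (s : MvPolynomial (Fin n) ℝ) : Prop :=
  ∃ (k : ℕ) (p : Fin k → MvPolynomial (Fin n) ℝ), s = ∑ i, (p i) ^ 2

/-- Membership in the preorder generated by inequalities `f₁,…,f_r` and
equations `g₁,…,g_s`: `q = ∑_{ε ∈ {0,1}^r} s_ε f₁^{ε₁}⋯f_r^{ε_r} + ∑ j pⱼ gⱼ`
with every `s_ε` SOS. -/
def InPreorder {n r s : ℕ} (f : Fin r → MvPolynomial (Fin n) ℝ)
    (g : Fin s → MvPolynomial (Fin n) ℝ) (q : MvPolynomial (Fin n) ℝ) : Prop :=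
  ∃ (σ : (Fin r → Bool) → MvPolynomial (Fin n) ℝ)
    (p : Fin s → MvPolynomial (Fin n) ℝ),
    (∀ ε, IsSOS (σ ε)) ∧
    q = (∑ ε : Fin r → Bool, σ ε * ∏ i, if ε i then f i else 1) + ∑ j, p j * g j

section kshelpers
open Polynomial

def KSIvt (R : Type) [Field R] [LinearOrder R] : Prop :=
  ∀ (p : R[X]) (a b : R), a < b → p.eval a * p.eval b < 0 → ∃ c, a < c ∧ c < b ∧ p.eval c = 0

section ivt
variable {R : Type} [Field R] [LinearOrder R] [IsStrictOrderedRing R]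

theorem ks_rolle_aux (hR : KSIvt R) (p : R[X]) (hp : p ≠ 0) (a b : R) (hab : a < b)
    (ha : p.eval a = 0) (hb : p.eval b = 0) (hno : ∀ c, a < c → c < b → p.eval c ≠ 0) :
    ∃ c, a < c ∧ c < b ∧ (derivative p).eval c = 0 := by
  obtain ⟨u, hu, hua⟩ := exists_eq_pow_rootMultiplicity_mul_and_not_dvd p hp a
  have hm : 0 < p.rootMultiplicity a := (rootMultiplicity_pos hp).2 ha
  obtain ⟨m, hm'⟩ : ∃ m, p.rootMultiplicity a = m + 1 := ⟨_, (Nat.succ_pred_eq_of_pos hm).symm⟩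
  rw [hm'] at hu
  have hu0 : u ≠ 0 := by rintro rfl; simp at hua
  have hub : u.eval b = 0 := by
    have := hb
    rw [hu] at this
    simp only [eval_mul, eval_pow, eval_sub, eval_X, eval_C, mul_eq_zero] at this
    rcases this with h | h
    · exact absurd (pow_eq_zero_iff (by omega) |>.1 h) (sub_pos.2 hab).ne'
    · exact h
  obtain ⟨Q, hQ, hQb⟩ := exists_eq_pow_rootMultiplicity_mul_and_not_dvd u hu0 b
  have hk : 0 < u.rootMultiplicity b := (rootMultiplicity_pos hu0).2 hub
  obtain ⟨k, hk'⟩ : ∃ k, u.rootMultiplicity b = k + 1 := ⟨_, (Nat.succ_pred_eq_of_pos hk).symm⟩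
  rw [hk'] at hQ
  rw [dvd_iff_isRoot, IsRoot] at hua hQb
  have hQa : Q.eval a ≠ 0 := by
    intro h; apply hua; rw [hQ]; simp [h]
  have hpQ : p = (X - C a) ^ (m+1) * ((X - C b) ^ (k+1) * Q) := by rw [← hQ]; exact hu
  have hQno : ∀ c, a < c → c < b → Q.eval c ≠ 0 := by
    intro c h1 h2 h; apply hno c h1 h2; rw [hpQ]; simp [h]
  have hQQ : 0 < Q.eval a * Q.eval b := by
    rcases lt_trichotomy (Q.eval a * Q.eval b) 0 with h | h | h
    · obtain ⟨c, h1, h2, h3⟩ := hR Q a b hab h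
      exact absurd h3 (hQno c h1 h2)
    · rcases mul_eq_zero.1 h with h | h
      · exact absurd h hQa
      · exact absurd h hQb
    · exact h
  set G : R[X] := C ((m:R)+1) * (X - C b) * Q + C ((k:R)+1) * (X - C a) * Q
    + (X - C a) * (X - C b) * derivative Q with hG
  have hder : derivative p = (X - C a) ^ m * (X - C b) ^ k * G := by
    rw [hpQ, hG]
    simp only [derivative_mul, derivative_pow, derivative_sub, derivative_X, derivative_C]
    simp only [Nat.add_sub_cancel, Nat.cast_add, Nat.cast_one, map_add, map_one, map_natCast]
    ring
  have hneg : G.eval a * G.eval b < 0 := by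
    have h1 : G.eval a = ((m:R)+1) * (a - b) * Q.eval a := by simp [hG]
    have h2 : G.eval b = ((k:R)+1) * (b - a) * Q.eval b := by simp [hG]
    have h3 : G.eval a * G.eval b =
      - ((((m:R)+1) * ((k:R)+1)) * (b-a)^2 * (Q.eval a * Q.eval b)) := by rw [h1, h2]; ring
    rw [h3]
    have : 0 < b - a := sub_pos.2 hab
    have : 0 < (((m:R)+1) * ((k:R)+1)) * (b-a)^2 * (Q.eval a * Q.eval b) := by positivity
    linarith
  obtain ⟨c, h1, h2, h3⟩ := hR G a b hab hneg
  exact ⟨c, h1, h2, by rw [hder]; simp [h3]⟩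

theorem ks_rolle (hR : KSIvt R) (p : R[X]) (a b : R) (hab : a < b)
    (ha : p.eval a = 0) (hb : p.eval b = 0) :
    ∃ c, a < c ∧ c < b ∧ (derivative p).eval c = 0 := by
  by_cases hp : p = 0
  · obtain ⟨c, h1, h2⟩ := exists_between hab
    exact ⟨c, h1, h2, by simp [hp]⟩
  let s := p.roots.toFinset.filter (fun x => a < x)
  have hbs : b ∈ s := by simp [s, hp, hab, hb]
  have hs : s.Nonempty := ⟨b, hbs⟩
  have hmin := s.min'_mem hs
  have hle := s.min'_le b hbs
  have hm2 : a < s.min' hs ∧ p.eval (s.min' hs) = 0 := by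
    generalize s.min' hs = y at hmin
    simp [s, hp] at hmin
    exact ⟨hmin.2, hmin.1⟩
  obtain ⟨c, h1, h2, h3⟩ := ks_rolle_aux hR p hp a _ hm2.1 ha hm2.2 (by
    intro c h1 h2 h3
    have : c ∈ s := by simp [s, hp, h1, h3]
    exact absurd (s.min'_le c this) (not_le.2 h2))
  exact ⟨c, h1, h2.trans_le hle, h3⟩

theorem ks_mvt (hR : KSIvt R) (p : R[X]) (a b : R) (hab : a < b) :
    ∃ c, a < c ∧ c < b ∧ p.eval b - p.eval a = (derivative p).eval c * (b - a) := by
  obtain ⟨c, h1, h2, h3⟩ := ks_rolle hR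
    (C (b - a) * (p - C (p.eval a)) - C (p.eval b - p.eval a) * (X - C a)) a b hab
    (by simp) (by simp; ring)
  refine ⟨c, h1, h2, ?_⟩
  simp at h3
  linarith

theorem ks_lt_of_deriv_pos (hR : KSIvt R) (p : R[X]) (a b : R) (hab : a < b)
    (h : ∀ c, a < c → c < b → 0 < (derivative p).eval c) : p.eval a < p.eval b := by
  obtain ⟨c, h1, h2, h3⟩ := ks_mvt hR p a b hab
  have := mul_pos (h c h1 h2) (sub_pos.2 hab)
  linarith

/-- sign at infinity -/
theorem ks_atTop (p : R[X]) (hp : p ≠ 0) :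
    ∃ M, ∀ x, M ≤ x → SignType.sign (p.eval x) = SignType.sign p.leadingCoeff := by
  have key : ∀ n (p : R[X]), p.natDegree = n → 0 < p.leadingCoeff →
      ∃ M, ∀ x, M ≤ x → p.leadingCoeff / 2 ≤ p.eval x := by
    intro n
    induction n with
    | zero =>
      intro p hp h0
      rw [natDegree_eq_zero] at hp
      obtain ⟨c, rfl⟩ := hp
      refine ⟨0, fun x _ => ?_⟩
      simp at h0 ⊢
      linarith
    | succ n ih =>
      intro p hp h0
      have hd : p.divX.natDegree = n := by rw [natDegree_divX_eq_natDegree_tsub_one, hp]; rfl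
      have hl : p.divX.leadingCoeff = p.leadingCoeff := by
        rw [leadingCoeff, leadingCoeff, hd, coeff_divX, hp]
      obtain ⟨M, hM⟩ := ih p.divX hd (hl ▸ h0)
      refine ⟨max M (1 + 2 * |p.coeff 0| / p.leadingCoeff), fun x hx => ?_⟩
      have h1 := hM x ((le_max_left _ _).trans hx)
      have h2 := (le_max_right _ _).trans hx
      rw [hl] at h1
      have h3 : p.eval x = p.divX.eval x * x + p.coeff 0 := by
        conv_lhs => rw [← divX_mul_X_add p]
        simp
      have h4 := neg_abs_le (p.coeff 0)
      have h5 : 0 ≤ |p.coeff 0| := abs_nonneg _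
      have h6 : p.leadingCoeff + 2 * |p.coeff 0| ≤ p.leadingCoeff * x := by
        have := mul_le_mul_of_nonneg_left h2 h0.le
        have e : p.leadingCoeff * (1 + 2 * |p.coeff 0| / p.leadingCoeff) =
          p.leadingCoeff + 2 * |p.coeff 0| := by field_simp
        linarith
      have h7 : 0 ≤ x := by
        have : 0 ≤ 2 * |p.coeff 0| / p.leadingCoeff := by positivity
        linarith
      have h8 := mul_le_mul_of_nonneg_right h1 h7
      rw [h3]
      linarith
  rcases lt_or_gt_of_ne (leadingCoeff_ne_zero.2 hp) with h | h
  · obtain ⟨M, hM⟩ := key _ (-p) rfl (by simpa using h)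
    refine ⟨M, fun x hx => ?_⟩
    have := hM x hx
    simp at this
    rw [sign_neg h, sign_neg (by linarith)]
  · obtain ⟨M, hM⟩ := key _ p rfl h
    refine ⟨M, fun x hx => ?_⟩
    have := hM x hx
    rw [sign_pos h, sign_pos (by linarith)]

theorem ks_atBot (p : R[X]) (hp : p ≠ 0) :
    ∃ M, ∀ x, x ≤ M → SignType.sign (p.eval x) =
      SignType.sign ((-1) ^ p.natDegree * p.leadingCoeff) := by
  obtain ⟨M, hM⟩ := ks_atTop (p.comp (-X)) (by
    intro h
    apply hp
    have := congrArg (fun q => q.comp (-X)) h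
    simpa [comp_assoc] using this)
  refine ⟨-M, fun x hx => ?_⟩
  have := hM (-x) (by linarith)
  rw [leadingCoeff_comp (by simp)] at this
  simp only [eval_comp, eval_neg, eval_X, neg_neg, leadingCoeff_neg, leadingCoeff_X] at this
  rw [this, mul_comm]
end ivt

section piso
variable {R₁ R₂ : Type} [Field R₁] [LinearOrder R₁] [IsStrictOrderedRing R₁]
  [Field R₂] [LinearOrder R₂] [IsStrictOrderedRing R₂]

def KSSC {R₁ R₂ : Type} [LinearOrder R₁] [LinearOrder R₂]
    (f : Finset (R₁ × R₂)) (t₁ : R₁) (t₂ : R₂) : Prop :=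
  ∀ p ∈ f, cmp p.1 t₁ = cmp p.2 t₂

def KSIso {R₁ R₂ : Type} [LinearOrder R₁] [LinearOrder R₂] (f : Finset (R₁ × R₂)) : Prop :=
  ∀ p ∈ f, ∀ q ∈ f, cmp p.1 q.1 = cmp p.2 q.2

def KSMatched (T : Set (R₁[X] × R₂[X])) (f : Finset (R₁ × R₂)) : Prop :=
  ∀ t₁ t₂, KSSC f t₁ t₂ → ∀ q ∈ T, SignType.sign (q.1.eval t₁) = SignType.sign (q.2.eval t₂)

theorem ks_across {f : Finset (R₁ × R₂)} (hf : KSIso f) (t₁ : R₁) : ∃ t₂, KSSC f t₁ t₂ :=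
  Order.PartialIso.exists_across (⟨f, hf⟩ : Order.PartialIso R₁ R₂) t₁

def KSswap (f : Finset (R₁ × R₂)) : Finset (R₂ × R₁) := f.map (Equiv.prodComm R₁ R₂).toEmbedding

theorem ks_mem_swap {f : Finset (R₁ × R₂)} {p : R₂ × R₁} : p ∈ KSswap f ↔ (p.2, p.1) ∈ f := by
  obtain ⟨a, b⟩ := p
  simp [KSswap]

theorem ks_iso_swap {f : Finset (R₁ × R₂)} (hf : KSIso f) : KSIso (KSswap f) := by
  intro p hp q hq
  rw [ks_mem_swap] at hp hq
  exact (hf _ hp _ hq).symm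

theorem ks_sc_swap {f : Finset (R₁ × R₂)} {t₁ t₂} : KSSC (KSswap f) t₂ t₁ ↔ KSSC f t₁ t₂ := by
  constructor
  · intro h p hp
    exact (h (p.2, p.1) (ks_mem_swap.2 hp)).symm
  · intro h p hp
    exact (h _ (ks_mem_swap.1 hp)).symm

theorem ks_matched_swap {T : Set (R₁[X] × R₂[X])} {f : Finset (R₁ × R₂)} (h : KSMatched T f) :
    KSMatched (Prod.swap ⁻¹' T) (KSswap f) := by
  intro t₂ t₁ hs q hq
  exact (h t₁ t₂ (ks_sc_swap.1 hs) (q.2, q.1) hq).symm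

theorem ks_across' {f : Finset (R₁ × R₂)} (hf : KSIso f) (t₂ : R₂) : ∃ t₁, KSSC f t₁ t₂ := by
  obtain ⟨t₁, h⟩ := ks_across (ks_iso_swap hf) t₂
  exact ⟨t₁, ks_sc_swap.1 h⟩

theorem ks_gap (s : Finset R₁) (r : R₁) : ∃ b, r < b ∧ ∀ y ∈ s, r < y → b ≤ y := by
  induction s using Finset.induction_on with
  | empty => exact ⟨r + 1, by simp, by simp⟩
  | insert a s _ ih =>
    obtain ⟨b, hb, h⟩ := ih
    by_cases hra : r < a
    · refine ⟨min a b, lt_min hra hb, fun y hy hry => ?_⟩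
      rcases Finset.mem_insert.1 hy with rfl | hy
      · exact min_le_left _ _
      · exact (min_le_right _ _).trans (h y hy hry)
    · refine ⟨b, hb, fun y hy hry => ?_⟩
      rcases Finset.mem_insert.1 hy with rfl | hy
      · exact absurd hry hra
      · exact h y hy hry

theorem ks_root_mem {T : Set (R₁[X] × R₂[X])} {f : Finset (R₁ × R₂)} (hf : KSIso f)
    (h : KSMatched T f) {q} (hq : q ∈ T) (hq0 : q.1 ≠ 0) {r : R₁} (hr : q.1.eval r = 0) :
    ∃ s, (r, s) ∈ f := by
  by_contra hno
  push Not at hno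
  obtain ⟨t₂, ht⟩ := ks_across hf r
  have h0 := h r t₂ ht q hq
  rw [hr, sign_zero] at h0
  obtain ⟨b, hb, hgap⟩ := ks_gap (f.image Prod.fst) r
  apply hq0
  apply Polynomial.eq_zero_of_infinite_isRoot
  apply (Set.Ioo_infinite hb).mono
  intro x hx
  have hsc : KSSC f x t₂ := by
    intro p hp
    rw [← ht p hp]
    rcases lt_trichotomy p.1 r with h | h | h
    · rw [cmp_eq_lt_iff _ _ |>.2 h, cmp_eq_lt_iff _ _ |>.2 (h.trans hx.1)]
    · exact absurd (by rw [← h]; exact hp) (hno p.2)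
    · rw [cmp_eq_gt_iff _ _ |>.2 h, cmp_eq_gt_iff _ _ |>.2]
      exact hx.2.trans_le (hgap _ (Finset.mem_image_of_mem _ hp) h)
  have := h x t₂ hsc q hq
  rw [← h0] at this
  exact sign_eq_zero_iff.1 this

theorem ks_root_mem' {T : Set (R₁[X] × R₂[X])} {f : Finset (R₁ × R₂)} (hf : KSIso f)
    (h : KSMatched T f) {q} (hq : q ∈ T) (hq0 : q.2 ≠ 0) {s : R₂} (hr : q.2.eval s = 0) :
    ∃ r, (r, s) ∈ f := by
  obtain ⟨r, hr⟩ := ks_root_mem (ks_iso_swap hf) (ks_matched_swap h) (q := (q.2, q.1)) hq hq0 hr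
  exact ⟨r, ks_mem_swap.1 hr⟩

theorem ks_ne_zero {T : Set (R₁[X] × R₂[X])} {f : Finset (R₁ × R₂)} (hf : KSIso f)
    (h : KSMatched T f) {q} (hq : q ∈ T) (hq0 : q.2 ≠ 0) : q.1 ≠ 0 := by
  intro h0
  apply hq0
  apply Polynomial.funext
  intro t₂
  obtain ⟨t₁, ht⟩ := ks_across' hf t₂
  have := h _ _ ht q hq
  rw [h0, eval_zero, sign_zero] at this
  rw [eval_zero]
  exact sign_eq_zero_iff.1 this.symm

theorem ks_ivt_closed (hR : KSIvt R₁) (q : R₁[X]) {x y : R₁} (hxy : x < y)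
    (h : SignType.sign (q.eval x) ≠ SignType.sign (q.eval y)) :
    ∃ c, x ≤ c ∧ c ≤ y ∧ q.eval c = 0 := by
  by_cases hx : q.eval x = 0
  · exact ⟨x, le_rfl, hxy.le, hx⟩
  by_cases hy : q.eval y = 0
  · exact ⟨y, hxy.le, le_rfl, hy⟩
  have : q.eval x * q.eval y < 0 := by
    rcases lt_or_gt_of_ne hx with h1 | h1 <;> rcases lt_or_gt_of_ne hy with h2 | h2
    · exact absurd (by rw [sign_neg h1, sign_neg h2]) h
    · exact mul_neg_of_neg_of_pos h1 h2
    · exact mul_neg_of_pos_of_neg h1 h2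
    · exact absurd (by rw [sign_pos h1, sign_pos h2]) h
  obtain ⟨c, h1, h2, h3⟩ := hR q x y hxy this
  exact ⟨c, h1.le, h2.le, h3⟩

open Classical in
theorem ks_restrict (hR₂ : KSIvt R₂) {S T : Set (R₁[X] × R₂[X])} (hTS : T ⊆ S)
    {f : Finset (R₁ × R₂)} (hf : KSIso f) (h : KSMatched S f) :
    ∃ f' : Finset (R₁ × R₂), f' ⊆ f ∧ KSIso f' ∧ KSMatched T f' ∧
      ∀ pt ∈ f', ∃ q ∈ T, q.1 ≠ 0 ∧ q.2 ≠ 0 ∧ q.1.eval pt.1 = 0 ∧ q.2.eval pt.2 = 0 := by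
  refine ⟨f.filter (fun pt => ∃ q ∈ T, q.1 ≠ 0 ∧ q.2 ≠ 0 ∧ q.1.eval pt.1 = 0 ∧
    q.2.eval pt.2 = 0), Finset.filter_subset _ _, ?_, ?_, ?_⟩
  · intro p hp q hq
    exact hf p (Finset.mem_filter.1 hp).1 q (Finset.mem_filter.1 hq).1
  · intro t₁ t₂ hs q hq
    obtain ⟨t₂', ht'⟩ := ks_across hf t₁
    rw [h _ _ ht' q (hTS hq)]
    by_cases hq0 : q.2 = 0
    · simp [hq0]
    have key : ∀ c, q.2.eval c = 0 → cmp c t₂ = cmp c t₂' := by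
      intro c hc
      obtain ⟨d, hd⟩ := ks_root_mem' hf h (hTS hq) hq0 hc
      have h1 : q.1 ≠ 0 := ks_ne_zero hf h (hTS hq) hq0
      have h2 : q.1.eval d = 0 := by
        have := h d c (fun p hp => hf p hp _ hd) q (hTS hq)
        rw [hc, sign_zero] at this
        exact sign_eq_zero_iff.1 this
      have h3 := hs (d, c) (Finset.mem_filter.2 ⟨hd, q, hq, h1, hq0, h2, hc⟩)
      have h4 := ht' (d, c) hd
      exact h3.symm.trans h4
    by_contra hne
    rcases lt_trichotomy t₂ t₂' with hlt | heq | hlt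
    · obtain ⟨c, h1, h2, h3⟩ := ks_ivt_closed hR₂ q.2 hlt (Ne.symm hne)
      have := key c h3
      have e1 := lt_iff_lt_of_cmp_eq_cmp this
      have e2 := eq_iff_eq_of_cmp_eq_cmp this
      rcases h2.lt_or_eq with h | h
      · exact absurd (e1.2 h) (not_lt.2 h1)
      · have := e2.2 h
        rw [← this, h] at hlt
        exact lt_irrefl _ hlt
    · rw [heq] at hne; exact hne rfl
    · obtain ⟨c, h1, h2, h3⟩ := ks_ivt_closed hR₂ q.2 hlt hne
      have := key c h3
      have e1 := lt_iff_lt_of_cmp_eq_cmp this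
      have e2 := eq_iff_eq_of_cmp_eq_cmp this
      rcases h2.lt_or_eq with h | h
      · exact absurd (e1.1 h) (not_lt.2 h1)
      · have := e2.1 h
        rw [← this, h] at hlt
        exact lt_irrefl _ hlt
  · intro pt hpt
    exact (Finset.mem_filter.1 hpt).2
end piso

section step
variable {R₁ R₂ : Type} [Field R₁] [LinearOrder R₁] [IsStrictOrderedRing R₁]
  [Field R₂] [LinearOrder R₂] [IsStrictOrderedRing R₂]

theorem ks_left {f : Finset (R₁ × R₂)} (hf : KSIso f) (P₁ : R₁[X]) (P₂ : R₂[X])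
    (h1 : P₁ ≠ 0) (h2 : P₂ ≠ 0) (hdeg : P₁.natDegree = P₂.natDegree)
    (hl : SignType.sign P₁.leadingCoeff = SignType.sign P₂.leadingCoeff)
    (hpt : ∀ p ∈ f, SignType.sign (P₁.eval p.1) = SignType.sign (P₂.eval p.2))
    {t₁ t₂} (hs : KSSC f t₁ t₂) (hn : ∀ p ∈ f, p.1 ≠ t₁) :
    ∃ u₁ u₂, u₁ < t₁ ∧ u₂ < t₂ ∧ SignType.sign (P₁.eval u₁) = SignType.sign (P₂.eval u₂) ∧
      (∀ x, u₁ < x → x ≤ t₁ → KSSC f x t₂) ∧ (∀ y, u₂ < y → y ≤ t₂ → KSSC f t₁ y) := by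
  by_cases hne : (f.filter (fun p => p.1 < t₁)).Nonempty
  · obtain ⟨z, hz, hmax⟩ := Finset.exists_max_image _ Prod.fst hne
    rw [Finset.mem_filter] at hz
    refine ⟨z.1, z.2, hz.2, (lt_iff_lt_of_cmp_eq_cmp (hs z hz.1)).1 hz.2, hpt z hz.1, ?_, ?_⟩
    · intro x hx hxt p hp
      rw [← hs p hp]
      rcases lt_or_gt_of_ne (hn p hp) with h | h
      · have := hmax p (Finset.mem_filter.2 ⟨hp, h⟩)
        rw [(cmp_eq_lt_iff _ _).2 h, (cmp_eq_lt_iff _ _).2 (this.trans_lt hx)]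
      · rw [(cmp_eq_gt_iff _ _).2 h, (cmp_eq_gt_iff _ _).2 (hxt.trans_lt h)]
    · intro y hy hyt p hp
      rw [hs p hp]
      rcases lt_or_gt_of_ne (hn p hp) with h | h
      · have h3 := hmax p (Finset.mem_filter.2 ⟨hp, h⟩)
        have h4 : p.2 ≤ z.2 := (le_iff_le_of_cmp_eq_cmp (hf p hp z hz.1)).1 h3
        have h5 : p.2 < t₂ := (lt_iff_lt_of_cmp_eq_cmp (hs p hp)).1 h
        rw [(cmp_eq_lt_iff _ _).2 h5, (cmp_eq_lt_iff _ _).2 (h4.trans_lt hy)]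
      · have h5 : t₂ < p.2 := (lt_iff_lt_of_cmp_eq_cmp (cmp_eq_cmp_symm.1 (hs p hp))).1 h
        rw [(cmp_eq_gt_iff _ _).2 h5, (cmp_eq_gt_iff _ _).2 (hyt.trans_lt h5)]
  · have hgt : ∀ p ∈ f, t₁ < p.1 := by
      intro p hp
      rcases lt_or_gt_of_ne (hn p hp) with h | h
      · exact absurd ⟨p, Finset.mem_filter.2 ⟨hp, h⟩⟩ hne
      · exact h
    obtain ⟨M₁, hM₁⟩ := ks_atBot P₁ h1
    obtain ⟨M₂, hM₂⟩ := ks_atBot P₂ h2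
    refine ⟨min M₁ (t₁ - 1), min M₂ (t₂ - 1), ?_, ?_, ?_, ?_, ?_⟩
    · exact (min_le_right _ _).trans_lt (by linarith)
    · exact (min_le_right _ _).trans_lt (by linarith)
    · rw [hM₁ _ (min_le_left _ _), hM₂ _ (min_le_left _ _), sign_mul, sign_mul, hl, hdeg]
      congr 1
      rcases Nat.even_or_odd P₂.natDegree with h | h <;> simp [h.neg_one_pow]
    · intro x _ hxt p hp
      rw [← hs p hp, (cmp_eq_gt_iff _ _).2 (hgt p hp),
        (cmp_eq_gt_iff _ _).2 (hxt.trans_lt (hgt p hp))]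
    · intro y _ hyt p hp
      have h5 : t₂ < p.2 := (lt_iff_lt_of_cmp_eq_cmp (cmp_eq_cmp_symm.1 (hs p hp))).1 (hgt p hp)
      rw [(cmp_eq_gt_iff _ _).2 (hgt p hp), (cmp_eq_gt_iff _ _).2 (hyt.trans_lt h5)]

theorem ks_right {f : Finset (R₁ × R₂)} (hf : KSIso f) (P₁ : R₁[X]) (P₂ : R₂[X])
    (h1 : P₁ ≠ 0) (h2 : P₂ ≠ 0)
    (hl : SignType.sign P₁.leadingCoeff = SignType.sign P₂.leadingCoeff)
    (hpt : ∀ p ∈ f, SignType.sign (P₁.eval p.1) = SignType.sign (P₂.eval p.2))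
    {t₁ t₂} (hs : KSSC f t₁ t₂) (hn : ∀ p ∈ f, p.1 ≠ t₁) :
    ∃ u₁ u₂, t₁ < u₁ ∧ t₂ < u₂ ∧ SignType.sign (P₁.eval u₁) = SignType.sign (P₂.eval u₂) ∧
      (∀ x, t₁ ≤ x → x < u₁ → KSSC f x t₂) ∧ (∀ y, t₂ ≤ y → y < u₂ → KSSC f t₁ y) := by
  have hs1 : ∀ p ∈ f, t₁ < p.1 → t₂ < p.2 := fun p hp =>
    (lt_iff_lt_of_cmp_eq_cmp (cmp_eq_cmp_symm.1 (hs p hp))).1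
  have hs2 : ∀ p ∈ f, p.1 < t₁ → p.2 < t₂ := fun p hp => (lt_iff_lt_of_cmp_eq_cmp (hs p hp)).1
  by_cases hne : (f.filter (fun p => t₁ < p.1)).Nonempty
  · obtain ⟨z, hz, hmin⟩ := Finset.exists_min_image _ Prod.fst hne
    rw [Finset.mem_filter] at hz
    refine ⟨z.1, z.2, hz.2, hs1 z hz.1 hz.2, hpt z hz.1, ?_, ?_⟩
    · intro x hxt hx p hp
      rw [← hs p hp]
      rcases lt_or_gt_of_ne (hn p hp) with h | h
      · rw [(cmp_eq_lt_iff _ _).2 h, (cmp_eq_lt_iff _ _).2 (h.trans_le hxt)]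
      · have := hmin p (Finset.mem_filter.2 ⟨hp, h⟩)
        rw [(cmp_eq_gt_iff _ _).2 h, (cmp_eq_gt_iff _ _).2 (hx.trans_le this)]
    · intro y hyt hy p hp
      rw [hs p hp]
      rcases lt_or_gt_of_ne (hn p hp) with h | h
      · have h5 := hs2 p hp h
        rw [(cmp_eq_lt_iff _ _).2 h5, (cmp_eq_lt_iff _ _).2 (h5.trans_le hyt)]
      · have h3 := hmin p (Finset.mem_filter.2 ⟨hp, h⟩)
        have h4 : z.2 ≤ p.2 := (le_iff_le_of_cmp_eq_cmp (hf z hz.1 p hp)).1 h3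
        have h5 := hs1 p hp h
        rw [(cmp_eq_gt_iff _ _).2 h5, (cmp_eq_gt_iff _ _).2 (hy.trans_le h4)]
  · have hgt : ∀ p ∈ f, p.1 < t₁ := by
      intro p hp
      rcases lt_or_gt_of_ne (hn p hp) with h | h
      · exact h
      · exact absurd ⟨p, Finset.mem_filter.2 ⟨hp, h⟩⟩ hne
    obtain ⟨M₁, hM₁⟩ := ks_atTop P₁ h1
    obtain ⟨M₂, hM₂⟩ := ks_atTop P₂ h2
    refine ⟨max M₁ (t₁ + 1), max M₂ (t₂ + 1), ?_, ?_, ?_, ?_, ?_⟩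
    · exact lt_of_lt_of_le (by linarith) (le_max_right _ _)
    · exact lt_of_lt_of_le (by linarith) (le_max_right _ _)
    · rw [hM₁ _ (le_max_left _ _), hM₂ _ (le_max_left _ _), hl]
    · intro x hxt _ p hp
      rw [← hs p hp, (cmp_eq_lt_iff _ _).2 (hgt p hp),
        (cmp_eq_lt_iff _ _).2 ((hgt p hp).trans_le hxt)]
    · intro y hyt _ p hp
      have h5 := hs2 p hp (hgt p hp)
      rw [(cmp_eq_lt_iff _ _).2 (hgt p hp), (cmp_eq_lt_iff _ _).2 (h5.trans_le hyt)]

/-- signs as inequalities -/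
theorem ks_sign_neg_iff {a : R₁} {b : R₂} (h : SignType.sign a = SignType.sign b) :
    (a < 0 ↔ b < 0) ∧ (0 < a ↔ 0 < b) := by
  rw [← sign_eq_neg_one_iff, ← sign_eq_neg_one_iff, ← sign_eq_one_iff, ← sign_eq_one_iff, h]
  simp

theorem ks_inc (hR₁ : KSIvt R₁) (hR₂ : KSIvt R₂) (P₁ : R₁[X]) (P₂ : R₂[X])
    {u₁ v₁ t₁ : R₁} {u₂ v₂ t₂ : R₂} (hu₁ : u₁ < t₁) (hv₁ : t₁ < v₁) (hu₂ : u₂ < t₂) (hv₂ : t₂ < v₂)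
    (hu : SignType.sign (P₁.eval u₁) = SignType.sign (P₂.eval u₂))
    (hv : SignType.sign (P₁.eval v₁) = SignType.sign (P₂.eval v₂))
    (hD₁ : ∀ x, u₁ < x → x < v₁ → 0 < (derivative P₁).eval x)
    (hD₂ : ∀ x, u₂ < x → x < v₂ → 0 < (derivative P₂).eval x) :
    (P₁.eval t₁ = 0 → ∃ s, u₂ < s ∧ s < v₂ ∧ P₂.eval s = 0) ∧
    (P₂.eval t₂ = 0 → ∃ s, u₁ < s ∧ s < v₁ ∧ P₁.eval s = 0) ∧
    ((∀ r₁ r₂, u₁ < r₁ → r₁ < v₁ → u₂ < r₂ → r₂ < v₂ → P₁.eval r₁ = 0 → P₂.eval r₂ = 0 →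
      cmp r₁ t₁ = cmp r₂ t₂) → SignType.sign (P₁.eval t₁) = SignType.sign (P₂.eval t₂)) := by
  have m₁ : ∀ x y, u₁ ≤ x → x < y → y ≤ v₁ → P₁.eval x < P₁.eval y := fun x y h1 h2 h3 =>
    ks_lt_of_deriv_pos hR₁ P₁ x y h2 fun c h4 h5 => hD₁ c (h1.trans_lt h4) (h5.trans_le h3)
  have m₂ : ∀ x y, u₂ ≤ x → x < y → y ≤ v₂ → P₂.eval x < P₂.eval y := fun x y h1 h2 h3 =>
    ks_lt_of_deriv_pos hR₂ P₂ x y h2 fun c h4 h5 => hD₂ c (h1.trans_lt h4) (h5.trans_le h3)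
  obtain ⟨hun, hup⟩ := ks_sign_neg_iff hu
  obtain ⟨hvn, hvp⟩ := ks_sign_neg_iff hv
  have a1 := m₁ u₁ t₁ le_rfl hu₁ hv₁.le
  have a2 := m₁ t₁ v₁ hu₁.le hv₁ le_rfl
  have b1 := m₂ u₂ t₂ le_rfl hu₂ hv₂.le
  have b2 := m₂ t₂ v₂ hu₂.le hv₂ le_rfl
  have r1 : P₁.eval u₁ < 0 → 0 < P₁.eval v₁ → ∃ s, u₁ < s ∧ s < v₁ ∧ P₁.eval s = 0 :=
    fun h1 h2 => hR₁ P₁ u₁ v₁ (hu₁.trans hv₁) (mul_neg_of_neg_of_pos h1 h2)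
  have r2 : P₂.eval u₂ < 0 → 0 < P₂.eval v₂ → ∃ s, u₂ < s ∧ s < v₂ ∧ P₂.eval s = 0 :=
    fun h1 h2 => hR₂ P₂ u₂ v₂ (hu₂.trans hv₂) (mul_neg_of_neg_of_pos h1 h2)
  refine ⟨fun h => ?_, fun h => ?_, fun h => ?_⟩
  · exact r2 (hun.1 (by linarith)) (hvp.1 (by linarith))
  · exact r1 (hun.2 (by linarith)) (hvp.2 (by linarith))
  · by_cases c1 : P₁.eval u₁ < 0
    · by_cases c2 : 0 < P₁.eval v₁
      · obtain ⟨s₁, h1, h2, h3⟩ := r1 c1 c2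
        obtain ⟨s₂, k1, k2, k3⟩ := r2 (hun.1 c1) (hvp.1 c2)
        have hc := h s₁ s₂ h1 h2 k1 k2 h3 k3
        rcases lt_trichotomy s₁ t₁ with e | e | e
        · have e' := (lt_iff_lt_of_cmp_eq_cmp hc).1 e
          have := m₁ _ _ h1.le e hv₁.le
          have := m₂ _ _ k1.le e' hv₂.le
          rw [sign_pos (by linarith), sign_pos (by linarith)]
        · have e' := (eq_iff_eq_of_cmp_eq_cmp hc).1 e
          rw [← e, ← e', h3, k3, sign_zero, sign_zero]
        · have e' := (lt_iff_lt_of_cmp_eq_cmp (cmp_eq_cmp_symm.1 hc)).1 e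
          have := m₁ _ _ hu₁.le e h2.le
          have := m₂ _ _ hu₂.le e' k2.le
          rw [sign_neg (by linarith), sign_neg (by linarith)]
      · have c2' : ¬ 0 < P₂.eval v₂ := fun h => c2 (hvp.2 h)
        rw [not_lt] at c2 c2'
        rw [sign_neg (by linarith), sign_neg (by linarith)]
    · have c1' : ¬ P₂.eval u₂ < 0 := fun h => c1 (hun.2 h)
      rw [not_lt] at c1 c1'
      rw [sign_pos (by linarith), sign_pos (by linarith)]

theorem ks_mono (hR₁ : KSIvt R₁) (hR₂ : KSIvt R₂) (P₁ : R₁[X]) (P₂ : R₂[X])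
    {u₁ v₁ t₁ : R₁} {u₂ v₂ t₂ : R₂} (hu₁ : u₁ < t₁) (hv₁ : t₁ < v₁) (hu₂ : u₂ < t₂) (hv₂ : t₂ < v₂)
    (hu : SignType.sign (P₁.eval u₁) = SignType.sign (P₂.eval u₂))
    (hv : SignType.sign (P₁.eval v₁) = SignType.sign (P₂.eval v₂))
    (σ : SignType) (hσ : σ ≠ 0)
    (hD₁ : ∀ x, u₁ < x → x < v₁ → SignType.sign ((derivative P₁).eval x) = σ)
    (hD₂ : ∀ x, u₂ < x → x < v₂ → SignType.sign ((derivative P₂).eval x) = σ) :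
    (P₁.eval t₁ = 0 → ∃ s, u₂ < s ∧ s < v₂ ∧ P₂.eval s = 0) ∧
    (P₂.eval t₂ = 0 → ∃ s, u₁ < s ∧ s < v₁ ∧ P₁.eval s = 0) ∧
    ((∀ r₁ r₂, u₁ < r₁ → r₁ < v₁ → u₂ < r₂ → r₂ < v₂ → P₁.eval r₁ = 0 → P₂.eval r₂ = 0 →
      cmp r₁ t₁ = cmp r₂ t₂) → SignType.sign (P₁.eval t₁) = SignType.sign (P₂.eval t₂)) := by
  rcases σ with _ | _ | _
  · exact absurd rfl hσ
  · have := ks_inc hR₁ hR₂ (-P₁) (-P₂) hu₁ hv₁ hu₂ hv₂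
      (by rw [eval_neg, eval_neg, Left.sign_neg, Left.sign_neg, hu])
      (by rw [eval_neg, eval_neg, Left.sign_neg, Left.sign_neg, hv])
      (fun x h1 h2 => by
        have := sign_eq_neg_one_iff.1 (hD₁ x h1 h2)
        simpa using this)
      (fun x h1 h2 => by
        have := sign_eq_neg_one_iff.1 (hD₂ x h1 h2)
        simpa using this)
    simpa only [eval_neg, neg_eq_zero, Left.sign_neg, neg_inj] using this
  · exact ks_inc hR₁ hR₂ P₁ P₂ hu₁ hv₁ hu₂ hv₂ hu hv
      (fun x h1 h2 => sign_eq_one_iff.1 (hD₁ x h1 h2))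
      (fun x h1 h2 => sign_eq_one_iff.1 (hD₂ x h1 h2))

open Classical in
theorem ks_step (hR₁ : KSIvt R₁) (hR₂ : KSIvt R₂) {T : Set (R₁[X] × R₂[X])}
    {f : Finset (R₁ × R₂)} (hf : KSIso f) (hT : KSMatched T f)
    (P₁ : R₁[X]) (P₂ : R₂[X]) (hpos : 1 ≤ P₁.natDegree) (hdeg : P₁.natDegree = P₂.natDegree)
    (hl : SignType.sign P₁.leadingCoeff = SignType.sign P₂.leadingCoeff)
    (hD : (derivative P₁, derivative P₂) ∈ T)
    (hpt : ∀ p ∈ f, SignType.sign (P₁.eval p.1) = SignType.sign (P₂.eval p.2)) :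
    ∃ f', KSIso f' ∧ KSMatched (insert (P₁, P₂) T) f' := by
  have hp1 : P₁ ≠ 0 := by rintro rfl; simp at hpos
  have hp2 : P₂ ≠ 0 := by rintro rfl; rw [hdeg] at hpos; simp at hpos
  have hd1 : derivative P₁ ≠ 0 := by
    intro h; have := derivative_eq_zero.1 h; omega
  have hd2 : derivative P₂ ≠ 0 := by
    intro h; have := derivative_eq_zero.1 h; omega
  -- gap data
  have gap : ∀ t₁ t₂, KSSC f t₁ t₂ → (∀ p ∈ f, p.1 ≠ t₁) →
      (P₁.eval t₁ = 0 → ∃ s, KSSC f t₁ s ∧ P₂.eval s = 0) ∧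
      (P₂.eval t₂ = 0 → ∃ s, KSSC f s t₂ ∧ P₁.eval s = 0) ∧
      ((∀ r₁ r₂, KSSC f r₁ r₂ → P₁.eval r₁ = 0 → P₂.eval r₂ = 0 →
        cmp r₁ t₁ = cmp r₂ t₂) → SignType.sign (P₁.eval t₁) = SignType.sign (P₂.eval t₂)) := by
    intro t₁ t₂ hs hn
    obtain ⟨u₁, u₂, hu1, hu2, hu, hux, huy⟩ := ks_left hf P₁ P₂ hp1 hp2 hdeg hl hpt hs hn
    obtain ⟨v₁, v₂, hv1, hv2, hv, hvx, hvy⟩ := ks_right hf P₁ P₂ hp1 hp2 hl hpt hs hn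
    have hx : ∀ x, u₁ < x → x < v₁ → KSSC f x t₂ := fun x h1 h2 => by
      rcases le_total x t₁ with h | h
      · exact hux x h1 h
      · exact hvx x h h2
    have hy : ∀ y, u₂ < y → y < v₂ → KSSC f t₁ y := fun x h1 h2 => by
      rcases le_total x t₂ with h | h
      · exact huy x h1 h
      · exact hvy x h h2
    have hσ : SignType.sign ((derivative P₁).eval t₁) ≠ 0 := by
      intro h0
      obtain ⟨s, hs'⟩ := ks_root_mem hf hT hD hd1 (sign_eq_zero_iff.1 h0)
      exact hn _ hs' rfl
    obtain ⟨A, B, Cc⟩ := ks_mono hR₁ hR₂ P₁ P₂ hu1 hv1 hu2 hv2 hu hv _ hσ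
      (fun x h1 h2 => (hT x t₂ (hx x h1 h2) _ hD).trans (hT t₁ t₂ hs _ hD).symm)
      (fun y h1 h2 => (hT t₁ y (hy y h1 h2) _ hD).symm)
    refine ⟨fun h => ?_, fun h => ?_, fun h => Cc ?_⟩
    · obtain ⟨s, h1, h2, h3⟩ := A h
      exact ⟨s, hy s h1 h2, h3⟩
    · obtain ⟨s, h1, h2, h3⟩ := B h
      exact ⟨s, hx s h1 h2, h3⟩
    · intro r₁ r₂ h1 h2 h3 h4 h5 h6
      refine h r₁ r₂ ?_ h5 h6
      intro p hp
      rw [hx r₁ h1 h2 p hp, ← hs p hp, hy r₂ h3 h4 p hp]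
  set N := (P₁.roots.toFinset ×ˢ P₂.roots.toFinset).filter (fun p => KSSC f p.1 p.2) with hN
  have memN : ∀ p, p ∈ N ↔ P₁.eval p.1 = 0 ∧ P₂.eval p.2 = 0 ∧ KSSC f p.1 p.2 := by
    intro p
    simp [hN, hp1, hp2, and_assoc]
  have lt12 : ∀ p ∈ N, ∀ q ∈ N, p.1 < q.1 → p.2 < q.2 := by
    intro p hp q hq hlt
    rw [memN] at hp hq
    obtain ⟨c, h1, h2, h3⟩ := ks_rolle hR₁ P₁ _ _ hlt hp.1 hq.1
    obtain ⟨w, hw⟩ := ks_root_mem hf hT hD hd1 h3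
    have e1 := (lt_iff_lt_of_cmp_eq_cmp (cmp_eq_cmp_symm.1 (hp.2.2 _ hw))).1 h1
    have e2 := (lt_iff_lt_of_cmp_eq_cmp (hq.2.2 _ hw)).1 h2
    exact e1.trans e2
  have lt21 : ∀ p ∈ N, ∀ q ∈ N, p.2 < q.2 → p.1 < q.1 := by
    intro p hp q hq hlt
    rw [memN] at hp hq
    obtain ⟨c, h1, h2, h3⟩ := ks_rolle hR₂ P₂ _ _ hlt hp.2.1 hq.2.1
    obtain ⟨w, hw⟩ := ks_root_mem' hf hT hD hd2 h3
    have e1 := (lt_iff_lt_of_cmp_eq_cmp (cmp_eq_cmp_symm.1 (hp.2.2 _ hw))).2 h1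
    have e2 := (lt_iff_lt_of_cmp_eq_cmp (hq.2.2 _ hw)).2 h2
    exact e1.trans e2
  refine ⟨f ∪ N, ?_, ?_⟩
  · intro p hp q hq
    rw [Finset.mem_union] at hp hq
    rcases hp with hp | hp <;> rcases hq with hq | hq
    · exact hf p hp q hq
    · exact ((memN q).1 hq).2.2 p hp
    · exact cmp_eq_cmp_symm.1 (((memN p).1 hp).2.2 q hq)
    · rcases lt_trichotomy p.1 q.1 with h | h | h
      · rw [(cmp_eq_lt_iff _ _).2 h, (cmp_eq_lt_iff _ _).2 (lt12 p hp q hq h)]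
      · rw [(cmp_eq_eq_iff _ _).2 h]
        symm
        rw [cmp_eq_eq_iff]
        rcases lt_trichotomy p.2 q.2 with h' | h' | h'
        · exact absurd (lt21 p hp q hq h') (by rw [h]; exact lt_irrefl _)
        · exact h'
        · exact absurd (lt21 q hq p hp h') (by rw [h]; exact lt_irrefl _)
      · rw [(cmp_eq_gt_iff _ _).2 h, (cmp_eq_gt_iff _ _).2 (lt12 q hq p hp h)]
  · intro t₁ t₂ hs q hq
    have hsf : KSSC f t₁ t₂ := fun p hp => hs p (Finset.mem_union_left _ hp)
    rcases hq with rfl | hq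
    · by_cases hn : ∀ p ∈ f, p.1 ≠ t₁
      · apply (gap t₁ t₂ hsf hn).2.2
        intro r₁ r₂ h1 h2 h3
        exact hs (r₁, r₂) (Finset.mem_union_right _ ((memN _).2 ⟨h2, h3, h1⟩))
      · push Not at hn
        obtain ⟨p, hp, rfl⟩ := hn
        have := (eq_iff_eq_of_cmp_eq_cmp (hsf p hp)).1 rfl
        rw [← this]
        exact hpt p hp
    · exact hT t₁ t₂ hsf q hq
end step

section elim
variable {A : Type} [CommRing A] {R₁ R₂ : Type} [Field R₁] [LinearOrder R₁] [IsStrictOrderedRing R₁]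
  [Field R₂] [LinearOrder R₂] [IsStrictOrderedRing R₂]

def KSAgree (φ₁ : A →+* R₁) (φ₂ : A →+* R₂) (E : Finset A) : Prop :=
  ∀ a ∈ E, SignType.sign (φ₁ a) = SignType.sign (φ₂ a)

def KSNorm (φ₂ : A →+* R₂) (p : A[X]) : Prop := p = 0 ∨ φ₂ p.leadingCoeff ≠ 0

theorem KSAgree.mono {φ₁ : A →+* R₁} {φ₂ : A →+* R₂} {E F : Finset A} (h : KSAgree φ₁ φ₂ F)
    (hEF : E ⊆ F) : KSAgree φ₁ φ₂ E := fun a ha => h a (hEF ha)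

theorem ks_sign_zero {a : R₁} {b : R₂} (h : SignType.sign a = SignType.sign b) :
    a = 0 ↔ b = 0 := by
  rw [← sign_eq_zero_iff, h, sign_eq_zero_iff]

open Classical in
theorem ks_normalize (φ₂ : A →+* R₂) (p : A[X]) : ∃ (p' : A[X]) (E : Finset A),
    p'.natDegree ≤ p.natDegree ∧ KSNorm φ₂ p' ∧ p'.map φ₂ = p.map φ₂ ∧
    ∀ φ₁ : A →+* R₁, KSAgree φ₁ φ₂ E → p'.map φ₁ = p.map φ₁ := by
  induction h : p.support.card using Nat.strong_induction_on generalizing p with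
  | _ n ih =>
    by_cases hp : p = 0
    · exact ⟨p, ∅, le_rfl, Or.inl hp, rfl, fun _ _ => rfl⟩
    by_cases hl : φ₂ p.leadingCoeff = 0
    · obtain ⟨p', E, h1, h2, h3, h4⟩ := ih _ (h ▸ eraseLead_support_card_lt hp) p.eraseLead rfl
      refine ⟨p', insert p.leadingCoeff E, h1.trans (natDegree_le_natDegree
        (eraseLead_degree_le)), h2, ?_, ?_⟩
      · rw [h3]
        have e := congrArg (Polynomial.map φ₂) (eraseLead_add_C_mul_X_pow p)
        rw [Polynomial.map_add, Polynomial.map_mul, map_C, hl, C_0, zero_mul, add_zero] at e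
        exact e
      · intro φ₁ hφ
        rw [h4 φ₁ (hφ.mono (Finset.subset_insert _ _))]
        have := (ks_sign_zero (hφ _ (Finset.mem_insert_self _ _))).2 hl
        have e := congrArg (Polynomial.map φ₁) (eraseLead_add_C_mul_X_pow p)
        rw [Polynomial.map_add, Polynomial.map_mul, map_C, this, C_0, zero_mul, add_zero] at e
        exact e
    · exact ⟨p, ∅, le_rfl, Or.inr hl, rfl, fun _ _ => rfl⟩

theorem ks_pdiv (Q : A[X]) (hQ : 1 ≤ Q.natDegree) (P : A[X]) : ∃ (e : ℕ) (U r : A[X]),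
    C (Q.leadingCoeff ^ e) * P = Q * U + r ∧ r.natDegree < Q.natDegree := by
  induction h : P.natDegree using Nat.strong_induction_on generalizing P with
  | _ n ih =>
    by_cases hlt : P.natDegree < Q.natDegree
    · exact ⟨0, 0, P, by simp, hlt⟩
    push Not at hlt
    obtain ⟨k, hk⟩ := Nat.exists_eq_add_of_le hlt
    obtain ⟨e, U, r, h1, h2⟩ := ih (C Q.leadingCoeff * P -
        C P.leadingCoeff * (Q * X ^ k)).natDegree (by
      suffices (C Q.leadingCoeff * P - C P.leadingCoeff * (Q * X ^ k)).natDegree ≤ n - 1 by omega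
      rw [natDegree_le_iff_coeff_eq_zero]
      intro N hN
      rw [coeff_sub, coeff_C_mul, coeff_C_mul]
      rcases (show n ≤ N by omega).lt_or_eq with h' | h'
      · rw [coeff_eq_zero_of_natDegree_lt (by omega), coeff_mul_X_pow',
          if_pos (by omega), coeff_eq_zero_of_natDegree_lt (p := Q) (by omega)]
        simp
      · subst h'
        rw [coeff_mul_X_pow', if_pos (by omega), leadingCoeff, leadingCoeff,
          show n - k = Q.natDegree by omega, h]
        ring) _ rfl
    refine ⟨e + 1, U + C (Q.leadingCoeff ^ e) * C P.leadingCoeff * X ^ k, r, ?_, h2⟩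
    have : C (Q.leadingCoeff ^ (e+1)) * P = C (Q.leadingCoeff ^ e) * (C Q.leadingCoeff * P -
        C P.leadingCoeff * (Q * X ^ k)) + Q * (C (Q.leadingCoeff ^ e) * C P.leadingCoeff * X ^ k) := by
      rw [pow_succ, C_mul]; ring
    rw [this, h1]; ring

open Classical in
theorem ks_rem (φ₂ : A →+* R₂) (P Q : A[X]) (hQ : KSNorm φ₂ Q) : ∃ (r : A[X]) (E : Finset A),
    KSNorm φ₂ r ∧ r.natDegree + 1 ≤ max 1 Q.natDegree ∧
    ∀ φ₁ : A →+* R₁, KSAgree φ₁ φ₂ E → ∀ z₁ z₂, Q.map φ₂ ≠ 0 → (Q.map φ₁).eval z₁ = 0 →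
      (Q.map φ₂).eval z₂ = 0 →
      SignType.sign ((r.map φ₁).eval z₁) = SignType.sign ((r.map φ₂).eval z₂) →
      SignType.sign ((P.map φ₁).eval z₁) = SignType.sign ((P.map φ₂).eval z₂) := by
  by_cases hd : 1 ≤ Q.natDegree
  · have hl : φ₂ Q.leadingCoeff ≠ 0 := by
      rcases hQ with rfl | h
      · simp at hd
      · exact h
    obtain ⟨e, U, r, h1, h2⟩ := ks_pdiv Q hd P
    obtain ⟨r', E, k1, k2, k3, k4⟩ := ks_normalize (R₁ := R₁) φ₂ (C (Q.leadingCoeff ^ e) * r)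
    refine ⟨r', insert Q.leadingCoeff E, k2, ?_, ?_⟩
    · have : (C (Q.leadingCoeff ^ e) * r).natDegree ≤ r.natDegree := natDegree_C_mul_le _ _
      rw [max_eq_right hd]; omega
    · intro φ₁ hφ z₁ z₂ _ q1 q2 hr
      have hl1 : φ₁ Q.leadingCoeff ≠ 0 := fun h =>
        hl ((ks_sign_zero (hφ _ (Finset.mem_insert_self _ _))).1 h)
      rw [k4 φ₁ (hφ.mono (Finset.subset_insert _ _)), k3] at hr
      have e1 := congrArg (fun p => (p.map φ₁).eval z₁) h1
      have e2 := congrArg (fun p => (p.map φ₂).eval z₂) h1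
      simp only [Polynomial.map_mul, Polynomial.map_add, eval_mul, eval_add, map_C, eval_C, q1, q2,
        zero_mul, zero_add] at e1 e2 hr
      rw [← e1, ← e2, ← mul_assoc, ← mul_assoc, sign_mul, sign_mul (_ * _)] at hr
      have s1 : SignType.sign (φ₁ (Q.leadingCoeff ^ e) * φ₁ (Q.leadingCoeff ^ e)) = 1 :=
        sign_pos (mul_self_pos.2 (by rw [map_pow]; exact pow_ne_zero _ hl1))
      have s2 : SignType.sign (φ₂ (Q.leadingCoeff ^ e) * φ₂ (Q.leadingCoeff ^ e)) = 1 :=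
        sign_pos (mul_self_pos.2 (by rw [map_pow]; exact pow_ne_zero _ hl))
      rw [s1, s2, one_mul, one_mul] at hr
      exact hr
  · refine ⟨0, ∅, Or.inl rfl, by simp, ?_⟩
    intro φ₁ _ z₁ z₂ h0 _ q2 _
    exfalso
    apply h0
    have : Q.natDegree = 0 := by omega
    rw [natDegree_eq_zero] at this
    obtain ⟨c, rfl⟩ := this
    simp only [map_C, eval_C] at q2
    simp [q2]

open Classical in
theorem ks_main (hR₁ : KSIvt R₁) (hR₂ : KSIvt R₂) (φ₂ : A →+* R₂) (d : ℕ) :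
    ∀ (k : ℕ) (S : Finset A[X]), (∀ p ∈ S, KSNorm φ₂ p ∧ p.natDegree ≤ d) →
      (S.filter (fun p => p.natDegree = d)).card ≤ k → ∃ E : Finset A, ∀ φ₁ : A →+* R₁,
      KSAgree φ₁ φ₂ E → ∃ f : Finset (R₁ × R₂), KSIso f ∧
        KSMatched ((fun p : A[X] => (p.map φ₁, p.map φ₂)) '' (S : Set A[X])) f := by
  induction d with
  | zero =>
    intro k S hS _
    refine ⟨S.image (fun p => p.coeff 0), fun φ₁ hφ => ⟨∅, by simp [KSIso], ?_⟩⟩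
    rintro t₁ t₂ _ _ ⟨p, hp, rfl⟩
    have hd := (hS p hp).2
    have := hφ _ (Finset.mem_image_of_mem _ hp)
    rw [eq_C_of_natDegree_le_zero hd]
    simpa using this
  | succ d ihd =>
    intro k
    induction k with
    | zero =>
      intro S hS hc
      refine ihd _ S (fun p hp => ⟨(hS p hp).1, ?_⟩) le_rfl
      have h1 := (hS p hp).2
      by_contra h2
      have : p ∈ S.filter (fun p => p.natDegree = d + 1) :=
        Finset.mem_filter.2 ⟨hp, by omega⟩
      rw [Finset.card_eq_zero.1 (Nat.le_zero.1 hc)] at this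
      simp at this
    | succ k ihk =>
      intro S hS hc
      by_cases hc' : (S.filter (fun p => p.natDegree = d + 1)).card ≤ k
      · exact ihk S hS hc'
      obtain ⟨P, hP⟩ : (S.filter (fun p => p.natDegree = d + 1)).Nonempty := by
        rw [← Finset.card_pos]; omega
      have hP' := hP
      rw [Finset.mem_filter] at hP
      obtain ⟨hPS, hPd⟩ := hP
      have hPl : φ₂ P.leadingCoeff ≠ 0 := by
        rcases (hS P hPS).1 with h | h
        · rw [h] at hPd; simp at hPd
        · exact h
      obtain ⟨D, ED, hD1, hD2, hD3, hD4⟩ := ks_normalize (R₁ := R₁) φ₂ (derivative P)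
      have hDd : D.natDegree ≤ d := by
        have := natDegree_derivative_le P
        omega
      set T : Finset A[X] := insert D (S.erase P) with hT
      have hTn : ∀ Q ∈ T, KSNorm φ₂ Q ∧ Q.natDegree ≤ d + 1 := by
        intro Q hQ
        rcases Finset.mem_insert.1 hQ with rfl | hQ
        · exact ⟨hD2, by omega⟩
        · exact hS Q (Finset.mem_of_mem_erase hQ)
      have hrem : ∀ Q : A[X], ∃ (r : A[X]) (E : Finset A), Q ∈ T → (
          KSNorm φ₂ r ∧ r.natDegree + 1 ≤ max 1 Q.natDegree ∧
          ∀ φ₁ : A →+* R₁, KSAgree φ₁ φ₂ E → ∀ z₁ z₂, Q.map φ₂ ≠ 0 → (Q.map φ₁).eval z₁ = 0 →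
            (Q.map φ₂).eval z₂ = 0 →
            SignType.sign ((r.map φ₁).eval z₁) = SignType.sign ((r.map φ₂).eval z₂) →
            SignType.sign ((P.map φ₁).eval z₁) = SignType.sign ((P.map φ₂).eval z₂)) := by
        intro Q
        by_cases hQ : Q ∈ T
        · obtain ⟨r, E, h⟩ := ks_rem (R₁ := R₁) φ₂ P Q (hTn Q hQ).1
          exact ⟨r, E, fun _ => h⟩
        · exact ⟨0, ∅, fun h => absurd h hQ⟩
      choose r Er hr using hrem
      have hrd : ∀ Q ∈ T, (r Q).natDegree ≤ d := by
        intro Q hQ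
        have h1 := (hr Q hQ).2.1
        have h2 := (hTn Q hQ).2
        omega
      obtain ⟨E₀, hE₀⟩ := ihk (T ∪ T.image r) (by
        intro p hp
        rcases Finset.mem_union.1 hp with hp | hp
        · exact hTn p hp
        · obtain ⟨Q, hQ, rfl⟩ := Finset.mem_image.1 hp
          exact ⟨(hr Q hQ).1, (hrd Q hQ).trans (by omega)⟩) (by
        have hsub : (T ∪ T.image r).filter (fun p => p.natDegree = d + 1) ⊆
            (S.filter (fun p => p.natDegree = d + 1)).erase P := by
          intro p hp
          rw [Finset.mem_filter] at hp
          obtain ⟨hp, hpd⟩ := hp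
          rcases Finset.mem_union.1 hp with hp | hp
          · rcases Finset.mem_insert.1 hp with rfl | hp
            · omega
            · rw [Finset.mem_erase] at hp ⊢
              exact ⟨hp.1, Finset.mem_filter.2 ⟨hp.2, hpd⟩⟩
          · obtain ⟨Q, hQ, rfl⟩ := Finset.mem_image.1 hp
            have := hrd Q hQ
            omega
        have h1 := Finset.card_le_card hsub
        rw [Finset.card_erase_of_mem hP'] at h1
        omega)
      refine ⟨insert P.leadingCoeff (E₀ ∪ ED ∪ T.biUnion Er), fun φ₁ hφ => ?_⟩
      have hφ0 : KSAgree φ₁ φ₂ E₀ := hφ.mono (by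
        intro x hx; simp [hx])
      have hφD : KSAgree φ₁ φ₂ ED := hφ.mono (by
        intro x hx; simp [hx])
      have hφr : ∀ Q ∈ T, KSAgree φ₁ φ₂ (Er Q) := fun Q hQ => hφ.mono (by
        intro x hx
        refine Finset.mem_insert_of_mem (Finset.mem_union_right _ ?_)
        exact Finset.mem_biUnion.2 ⟨Q, hQ, hx⟩)
      have hlead := hφ _ (Finset.mem_insert_self _ _)
      have hPl1 : φ₁ P.leadingCoeff ≠ 0 := fun h => hPl ((ks_sign_zero hlead).1 h)
      obtain ⟨f₀, hf₀, hm₀⟩ := hE₀ φ₁ hφ0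
      obtain ⟨f, hff, hf, hm, hroot⟩ := ks_restrict hR₂
        (T := (fun p : A[X] => (p.map φ₁, p.map φ₂)) '' (T : Set A[X]))
        (Set.image_mono (by intro x hx; simp only [Finset.mem_coe] at hx ⊢
                            exact Finset.mem_union_left _ hx)) hf₀ hm₀
      obtain ⟨f', hf', hm'⟩ := ks_step hR₁ hR₂ hf hm (P.map φ₁) (P.map φ₂)
        (by rw [natDegree_map_of_leadingCoeff_ne_zero _ hPl1]; omega)
        (by rw [natDegree_map_of_leadingCoeff_ne_zero _ hPl1,
          natDegree_map_of_leadingCoeff_ne_zero _ hPl])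
        (by rw [leadingCoeff_map_of_leadingCoeff_ne_zero _ hPl1,
          leadingCoeff_map_of_leadingCoeff_ne_zero _ hPl]; exact hlead)
        ⟨D, Finset.mem_insert_self _ _, by
          simp only [Prod.mk.injEq]
          rw [hD4 φ₁ hφD, hD3, derivative_map, derivative_map]
          exact ⟨rfl, rfl⟩⟩
        (by
          intro pt hpt
          obtain ⟨_, ⟨Q, hQ, rfl⟩, _, q2, q3, q4⟩ := hroot pt hpt
          refine (hr Q hQ).2.2 φ₁ (hφr Q hQ) pt.1 pt.2 q2 q3 q4 ?_
          exact hm₀ pt.1 pt.2 (fun p hp => hf₀ p hp pt (hff hpt)) _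
            ⟨r Q, by
              simp only [Finset.mem_coe]
              exact Finset.mem_union_right _ (Finset.mem_image_of_mem _ hQ), rfl⟩)
      refine ⟨f', hf', ?_⟩
      intro t₁ t₂ hs q hq
      apply hm' t₁ t₂ hs
      obtain ⟨p, hp, rfl⟩ := hq
      by_cases hpP : p = P
      · left; rw [hpP]
      · right
        exact ⟨p, Finset.mem_insert_of_mem (Finset.mem_erase.2 ⟨hpP, hp⟩), rfl⟩

open Classical in
theorem ks_one (hR₁ : KSIvt R₁) (hR₂ : KSIvt R₂) (φ₂ : A →+* R₂) (S : Finset A[X]) :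
    ∃ E : Finset A, ∀ φ₁ : A →+* R₁, KSAgree φ₁ φ₂ E → ∀ t₂ : R₂, ∃ t₁ : R₁, ∀ p ∈ S,
      SignType.sign ((p.map φ₁).eval t₁) = SignType.sign ((p.map φ₂).eval t₂) := by
  choose N EN h1 h2 h3 h4 using ks_normalize (R₁ := R₁) φ₂
  obtain ⟨E, hE⟩ := ks_main hR₁ hR₂ φ₂ ((S.image N).sup natDegree) _ (S.image N) (by
    intro p hp
    refine ⟨?_, Finset.le_sup hp⟩
    obtain ⟨q, _, rfl⟩ := Finset.mem_image.1 hp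
    exact h2 q) le_rfl
  refine ⟨E ∪ S.biUnion EN, fun φ₁ hφ t₂ => ?_⟩
  obtain ⟨f, hf, hm⟩ := hE φ₁ (hφ.mono Finset.subset_union_left)
  obtain ⟨t₁, ht⟩ := ks_across' hf t₂
  refine ⟨t₁, fun p hp => ?_⟩
  have := hm t₁ t₂ ht _ ⟨N p, Finset.mem_coe.2 (Finset.mem_image_of_mem _ hp), rfl⟩
  simp only [h3] at this
  rwa [h4 p φ₁ (hφ.mono (by
    intro x hx
    exact Finset.mem_union_right _ (Finset.mem_biUnion.2 ⟨p, hp, hx⟩)))] at this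
end elim

theorem ks_real_ivt : KSIvt ℝ := by
  intro p a b hab h
  have hc : ContinuousOn (fun x => p.eval x) (Set.Icc a b) := p.continuous.continuousOn
  rcases mul_neg_iff.1 h with ⟨h1, h2⟩ | ⟨h1, h2⟩
  · obtain ⟨c, hc1, hc2⟩ := intermediate_value_Ioo' hab.le hc (show (0:ℝ) ∈ Set.Ioo _ _ from ⟨h2, h1⟩)
    exact ⟨c, hc1.1, hc1.2, hc2⟩
  · obtain ⟨c, hc1, hc2⟩ := intermediate_value_Ioo hab.le hc (show (0:ℝ) ∈ Set.Ioo _ _ from ⟨h1, h2⟩)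
    exact ⟨c, hc1.1, hc1.2, hc2⟩

section transfer
variable {R₂ : Type} [Field R₂] [LinearOrder R₂] [IsStrictOrderedRing R₂]

theorem ks_real_sign (ι : ℝ →+* R₂) (a : ℝ) : SignType.sign a = SignType.sign (ι a) := by
  have key : ∀ a : ℝ, 0 < a → 0 < ι a := by
    intro a ha
    rw [← Real.mul_self_sqrt ha.le, map_mul]
    exact mul_self_pos.2 ((map_ne_zero ι).2 (Real.sqrt_pos.2 ha).ne')
  rcases lt_trichotomy a 0 with h | h | h
  · have := key (-a) (by linarith)
    rw [map_neg] at this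
    rw [sign_neg h, sign_neg (by linarith)]
  · simp [h]
  · rw [sign_pos h, sign_pos (key a h)]

theorem ks_transfer (hR₂ : KSIvt R₂) (n : ℕ) : ∀ (φ : MvPolynomial (Fin n) ℝ →+* R₂)
    (S : Finset (MvPolynomial (Fin n) ℝ)), ∃ x : Fin n → ℝ, ∀ p ∈ S,
      SignType.sign (MvPolynomial.eval x p) = SignType.sign (φ p) := by
  classical
  induction n with
  | zero =>
    intro φ S
    refine ⟨Fin.elim0, fun p _ => ?_⟩
    obtain ⟨c, rfl⟩ := MvPolynomial.C_surjective (Fin 0) p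
    rw [MvPolynomial.eval_C]
    exact ks_real_sign (φ.comp MvPolynomial.C) c
  | succ n ih =>
    intro φ S
    let e := MvPolynomial.finSuccEquiv ℝ n
    let ψ : Polynomial (MvPolynomial (Fin n) ℝ) →+* R₂ := φ.comp e.symm.toRingEquiv.toRingHom
    let φ₂ : MvPolynomial (Fin n) ℝ →+* R₂ := ψ.comp Polynomial.C
    have hψ : ∀ p : Polynomial (MvPolynomial (Fin n) ℝ), ψ p = (p.map φ₂).eval (ψ X) := by
      intro p
      rw [eval_map]
      have : ψ = eval₂RingHom φ₂ (ψ X) := by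
        apply Polynomial.ringHom_ext
        · intro a; simp [φ₂]
        · simp
      exact congrArg (fun g => g p) this
    obtain ⟨E, hE⟩ := ks_one ks_real_ivt hR₂ φ₂ (S.image e)
    obtain ⟨x, hx⟩ := ih φ₂ E
    obtain ⟨t, ht⟩ := hE (MvPolynomial.eval x) hx (ψ X)
    refine ⟨Fin.cons t x, fun p hp => ?_⟩
    have := ht (e p) (Finset.mem_image_of_mem _ hp)
    rw [← hψ] at this
    rw [MvPolynomial.eval_eq_eval_mv_eval']
    rw [this]
    simp [ψ]
end transfer

section primecone

structure KSPre {B : Type} [CommRing B] (Q : Set B) : Prop where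
  add : ∀ a ∈ Q, ∀ b ∈ Q, a + b ∈ Q
  mul : ∀ a ∈ Q, ∀ b ∈ Q, a * b ∈ Q
  sq : ∀ a, a * a ∈ Q

variable {B : Type} [CommRing B]

theorem KSPre.zero {Q : Set B} (h : KSPre Q) : (0 : B) ∈ Q := by simpa using h.sq 0
theorem KSPre.one {Q : Set B} (h : KSPre Q) : (1 : B) ∈ Q := by simpa using h.sq 1
theorem KSPre.pow {Q : Set B} (h : KSPre Q) (q : B) (m : ℕ) : q ^ (2 * m) ∈ Q := by
  have := h.sq (q ^ m); rwa [← pow_add, ← two_mul] at this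

theorem KSPre.ext {Q : Set B} (h : KSPre Q) (a : B) :
    KSPre {x | ∃ s ∈ Q, ∃ t ∈ Q, x = s + a * t} where
  add := by
    rintro _ ⟨s, hs, t, ht, rfl⟩ _ ⟨s', hs', t', ht', rfl⟩
    exact ⟨s + s', h.add _ hs _ hs', t + t', h.add _ ht _ ht', by ring⟩
  mul := by
    rintro _ ⟨s, hs, t, ht, rfl⟩ _ ⟨s', hs', t', ht', rfl⟩
    exact ⟨s * s' + (a * a) * (t * t'), h.add _ (h.mul _ hs _ hs') _ (h.mul _ (h.sq a) _ (h.mul _ ht _ ht')),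
      s * t' + t * s', h.add _ (h.mul _ hs _ ht') _ (h.mul _ ht _ hs'), by ring⟩
  sq := fun x => ⟨x * x, h.sq x, 0, h.zero, by ring⟩

theorem ks_prime_cone (q : B) (Q0 : Set B) (h0 : KSPre Q0) (hq : ∀ m : ℕ, -q ^ (2 * m) ∉ Q0) :
    ∃ Q : Set B, Q0 ⊆ Q ∧ KSPre Q ∧ (∀ m : ℕ, -q ^ (2 * m) ∉ Q) ∧ (∀ a, a ∈ Q ∨ -a ∈ Q) ∧
      (∀ a b, a * b ∈ Q → -(a * b) ∈ Q → (a ∈ Q ∧ -a ∈ Q) ∨ (b ∈ Q ∧ -b ∈ Q)) := by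
  obtain ⟨M, hM0, hM⟩ := zorn_subset_nonempty {Q : Set B | KSPre Q ∧ ∀ m : ℕ, -q ^ (2 * m) ∉ Q}
    (by
      intro c hc hch hne
      refine ⟨⋃₀ c, ⟨⟨?_, ?_, ?_⟩, ?_⟩, fun s hs => Set.subset_sUnion_of_mem hs⟩
      · rintro a ⟨s, hs, ha⟩ b ⟨t, ht, hb⟩
        rcases hch.total hs ht with h | h
        · exact ⟨t, ht, (hc ht).1.add _ (h ha) _ hb⟩
        · exact ⟨s, hs, (hc hs).1.add _ ha _ (h hb)⟩
      · rintro a ⟨s, hs, ha⟩ b ⟨t, ht, hb⟩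
        rcases hch.total hs ht with h | h
        · exact ⟨t, ht, (hc ht).1.mul _ (h ha) _ hb⟩
        · exact ⟨s, hs, (hc hs).1.mul _ ha _ (h hb)⟩
      · intro a
        obtain ⟨s, hs⟩ := hne
        exact ⟨s, hs, (hc hs).1.sq a⟩
      · rintro m ⟨s, hs, h⟩
        exact (hc hs).2 m h) Q0 ⟨h0, hq⟩
  have hP : KSPre M := hM.prop.1
  have key : ∀ a, a ∉ M → ∃ m : ℕ, ∃ s ∈ M, ∃ t ∈ M, -q ^ (2 * m) = s + a * t := by
    intro a ha
    by_contra hcon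
    push Not at hcon
    have hsub := hM.le_of_ge (y := {x | ∃ s ∈ M, ∃ t ∈ M, x = s + a * t})
      ⟨hP.ext a, by rintro m ⟨s, hs, t, ht, h⟩; exact hcon m s hs t ht h⟩
      (fun x hx => ⟨x, hx, 0, hP.zero, by ring⟩)
    exact ha (hsub ⟨0, hP.zero, 1, hP.one, by ring⟩)
  have htot : ∀ a, a ∈ M ∨ -a ∈ M := by
    intro a
    by_contra! hcon
    obtain ⟨m, s, hs, t, ht, h⟩ := key _ hcon.1
    obtain ⟨k, s', hs', t', ht', h'⟩ := key _ hcon.2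
    refine hM.prop.2 (m + k) ?_
    have e : -q ^ (2 * (m + k)) = q ^ (2 * m) * s' + q ^ (2 * k) * s + s * s' + (a * a) * (t * t') := by
      rw [mul_add, pow_add]
      linear_combination (a * t') * h + (q ^ (2*m) + s) * h'
    rw [e]
    exact hP.add _ (hP.add _ (hP.add _ (hP.mul _ (hP.pow q m) _ hs') _ (hP.mul _ (hP.pow q k) _ hs)) _
      (hP.mul _ hs _ hs')) _ (hP.mul _ (hP.sq a) _ (hP.mul _ ht _ ht'))
  have hpr : ∀ a b, a * b ∈ M → -(a * b) ∈ M → a ∉ M → b ∉ M → False := by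
    intro a b h1 h2 ha hb
    obtain ⟨m, s, hs, t, ht, h⟩ := key _ ha
    obtain ⟨k, s', hs', t', ht', h'⟩ := key _ hb
    refine hM.prop.2 (m + k) ?_
    have e : -q ^ (2 * (m + k)) = -(a * b) * (t * t') + (q ^ (2 * m) * s' + q ^ (2 * k) * s + s * s') := by
      rw [mul_add, pow_add]
      linear_combination (-(b * t') ) * h + (q ^ (2*m) + s) * h'
    rw [e]
    exact hP.add _ (hP.mul _ h2 _ (hP.mul _ ht _ ht')) _ (hP.add _ (hP.add _ (hP.mul _ (hP.pow q m) _ hs') _ (hP.mul _ (hP.pow q k) _ hs)) _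
      (hP.mul _ hs _ hs'))
  refine ⟨M, hM0, hP, hM.prop.2, htot, ?_⟩
  intro a b h1 h2
  by_contra! hcon
  obtain ⟨c1, c2⟩ := hcon
  by_cases ha : a ∈ M <;> by_cases hb : b ∈ M
  · exact hpr (-a) (-b) (by simpa using h1) (by simpa using h2) (c1 ha) (c2 hb)
  · exact hpr (-a) b (by simpa using h2) (by simpa using h1) (c1 ha) hb
  · exact hpr a (-b) (by simpa using h2) (by simpa using h1) ha (c2 hb)
  · exact hpr a b h1 h2 ha hb

end primecone

section lemE
variable {L : Type} [Field L] [LinearOrder L] [IsStrictOrderedRing L]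

theorem ks_sumsq_natDegree {ι : Type} (I : Finset ι) (c : ι → L) (hc : ∀ i ∈ I, 0 ≤ c i) (h : ι → L[X]) (d : ℕ)
    (hd : ∀ i ∈ I, (h i).natDegree < d) :
    (1 + ∑ i ∈ I, C (c i) * (h i * h i)).natDegree ≤ 2 * (d - 1) := by
  refine (natDegree_add_le _ _).trans (max_le (by simp) ?_)
  refine natDegree_sum_le_of_forall_le _ _ fun i hi => ?_
  refine (natDegree_C_mul_le _ _).trans (natDegree_mul_le.trans ?_)
  have := hd i hi
  omega

theorem ks_lemE {ι : Type} (I : Finset ι) (c : ι → L) (hc : ∀ i ∈ I, 0 ≤ c i) : ∀ (d : ℕ) (p : L[X]), p.natDegree = d →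
    ∀ (a b : L), p.eval a * p.eval b < 0 → ∀ h : ι → L[X],
    ¬ p ∣ 1 + ∑ i ∈ I, C (c i) * (h i * h i) := by
  intro d
  induction d using Nat.strong_induction_on with
  | _ d ih =>
  intro p hpd a b hab h hdvd
  have hp0 : p ≠ 0 := by rintro rfl; simp at hab
  have hdpos : 0 < d := by
    by_contra hcon
    have : p.natDegree = 0 := by omega
    rw [eq_C_of_natDegree_eq_zero this] at hab
    simp at hab
    nlinarith [mul_self_nonneg (p.coeff 0)]
  let h' : ι → L[X] := fun i => h i % p
  have hh' : ∀ i, p ∣ h i * h i - h' i * h' i := by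
    intro i
    have : p ∣ h i - h' i := ⟨h i / p, by
      have := EuclideanDomain.div_add_mod (h i) p
      simp only [h']; linear_combination -this⟩
    have e : h i * h i - h' i * h' i = (h i - h' i) * (h i + h' i) := by ring
    rw [e]; exact this.mul_right _
  have hdvd' : p ∣ 1 + ∑ i ∈ I, C (c i) * (h' i * h' i) := by
    have e : 1 + ∑ i ∈ I, C (c i) * (h' i * h' i) = (1 + ∑ i ∈ I, C (c i) * (h i * h i))
       - ∑ i ∈ I, C (c i) * (h i * h i - h' i * h' i) := by
      simp only [mul_sub, Finset.sum_sub_distrib]; ring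
    rw [e]
    exact dvd_sub hdvd (Finset.dvd_sum fun i _ => (hh' i).mul_left _)
  have hdeg := ks_sumsq_natDegree I c hc h' d (fun i _ => by
    rw [← hpd]; exact natDegree_mod_lt _ (by omega))
  obtain ⟨r, hr⟩ := hdvd'
  have hpos : ∀ x : L, 0 < (1 + ∑ i ∈ I, C (c i) * (h' i * h' i)).eval x := by
    intro x
    simp only [eval_add, eval_one, eval_finsetSum, eval_mul, eval_C]
    have : 0 ≤ ∑ i ∈ I, c i * (eval x (h' i) * eval x (h' i)) :=
      Finset.sum_nonneg fun i hi => mul_nonneg (hc i hi) (mul_self_nonneg _)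
    linarith
  have ha := hpos a
  have hb := hpos b
  rw [hr, eval_mul] at ha hb
  have hr0 : r ≠ 0 := by rintro rfl; simp at ha
  rw [hr, natDegree_mul hp0 hr0] at hdeg
  refine ih r.natDegree (by omega) r rfl a b ?_ h' ⟨p, by rw [hr]; ring⟩
  by_contra hcon
  push Not at hcon
  have := mul_pos ha hb
  nlinarith [mul_nonneg hcon (neg_nonneg.2 hab.le)]

/-- irreducible factor with a sign change -/
theorem ks_irred_factor : ∀ (d : ℕ) (p : L[X]), p.natDegree = d →
    ∀ (a b : L), p.eval a * p.eval b < 0 → ∃ p0, Irreducible p0 ∧ p0 ∣ p ∧ p0.eval a * p0.eval b < 0 := by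
  intro d
  induction d using Nat.strong_induction_on with
  | _ d ih =>
  intro p hpd a b hab
  by_cases hirr : Irreducible p
  · exact ⟨p, hirr, dvd_rfl, hab⟩
  have hp0 : p ≠ 0 := by rintro rfl; simp at hab
  have hnu : ¬ IsUnit p := by
    intro hu
    obtain ⟨c, _, rfl⟩ := Polynomial.isUnit_iff.1 hu
    simp at hab
    nlinarith [mul_self_nonneg c]
  obtain ⟨u, v, hu, hv, huv⟩ : ∃ u v, ¬ IsUnit u ∧ ¬ IsUnit v ∧ p = u * v := by
    rw [irreducible_iff] at hirr
    push Not at hirr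
    obtain ⟨u, v, h, h1, h2⟩ := hirr hnu
    exact ⟨u, v, h1, h2, h⟩
  have hu0 : u ≠ 0 := by rintro rfl; simp at huv; exact hp0 huv
  have hv0 : v ≠ 0 := by rintro rfl; simp at huv; exact hp0 huv
  have hdu : 0 < u.natDegree := by
    rw [Nat.pos_iff_ne_zero]; intro h
    rw [eq_C_of_natDegree_eq_zero h] at hu hu0
    exact hu (isUnit_C.2 (isUnit_iff_ne_zero.2 (by simpa using hu0)))
  have hdv : 0 < v.natDegree := by
    rw [Nat.pos_iff_ne_zero]; intro h
    rw [eq_C_of_natDegree_eq_zero h] at hv hv0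
    exact hv (isUnit_C.2 (isUnit_iff_ne_zero.2 (by simpa using hv0)))
  have hdd : u.natDegree + v.natDegree = d := by rw [← hpd, huv, natDegree_mul hu0 hv0]
  have : (u.eval a * u.eval b) * (v.eval a * v.eval b) < 0 := by
    rw [huv] at hab; simp only [eval_mul] at hab; linarith
  rcases mul_neg_iff.1 this with h | h
  · obtain ⟨p0, h1, h2, h3⟩ := ih v.natDegree (by omega) v rfl a b h.2
    exact ⟨p0, h1, huv ▸ h2.mul_left _, h3⟩
  · obtain ⟨p0, h1, h2, h3⟩ := ih u.natDegree (by omega) u rfl a b h.1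
    exact ⟨p0, h1, huv ▸ h2.mul_right _, h3⟩

/-- ordering cone on AdjoinRoot -/
theorem ks_adjoin_cone (p : L[X]) [Fact (Irreducible p)] (a b : L) (hab : p.eval a * p.eval b < 0) :
    ∃ Q : Set (AdjoinRoot p), KSPre Q ∧ (∀ c : L, 0 ≤ c → AdjoinRoot.of p c ∈ Q) ∧ (∀ x, x ∈ Q ∨ -x ∈ Q) ∧
      (∀ x, x ∈ Q → -x ∈ Q → x = 0) := by
  let Q0 : Set (AdjoinRoot p) := {x | ∃ l : List (L × L[X]), (∀ y ∈ l, 0 ≤ y.1) ∧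
    x = (l.map fun y => AdjoinRoot.mk p (C y.1 * (y.2 * y.2))).sum}
  have hadd : ∀ x ∈ Q0, ∀ y ∈ Q0, x + y ∈ Q0 := by
    rintro _ ⟨l, hl, rfl⟩ _ ⟨l', hl', rfl⟩
    refine ⟨l ++ l', ?_, by simp⟩
    intro y hy
    rcases List.mem_append.1 hy with h | h
    exacts [hl _ h, hl' _ h]
  have hz : (0 : AdjoinRoot p) ∈ Q0 := ⟨[], by simp, by simp⟩
  have hcs : ∀ (c : L) (h : L[X]), 0 ≤ c → AdjoinRoot.mk p (C c * (h * h)) ∈ Q0 := by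
    intro c h hc
    exact ⟨[(c, h)], by simpa using hc, by simp⟩
  have hcm : ∀ (c : L) (h : L[X]), 0 ≤ c → ∀ x ∈ Q0, AdjoinRoot.mk p (C c * (h * h)) * x ∈ Q0 := by
    rintro c h hc _ ⟨l, hl, rfl⟩
    induction l with
    | nil => simpa using hz
    | cons y l ih =>
      rw [List.map_cons, List.sum_cons, mul_add]
      refine hadd _ ?_ _ (ih fun y hy => hl y (List.mem_cons_of_mem _ hy))
      have := hcs (c * y.1) (h * y.2) (mul_nonneg hc (hl y List.mem_cons_self))
      rw [← map_mul]
      convert this using 2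
      rw [C_mul]; ring
  have hpre : KSPre Q0 := by
    refine ⟨hadd, ?_, ?_⟩
    · rintro _ ⟨l, hl, rfl⟩ y hy
      induction l with
      | nil => simpa using hz
      | cons z l ih =>
        rw [List.map_cons, List.sum_cons, add_mul]
        exact hadd _ (hcm _ _ (hl z List.mem_cons_self) _ hy) _ (ih fun y hy => hl y (List.mem_cons_of_mem _ hy))
    · intro x
      obtain ⟨h, rfl⟩ := AdjoinRoot.mk_surjective x
      have := hcs 1 h zero_le_one
      simpa using this
  have hneg : ∀ m : ℕ, -(1 : AdjoinRoot p) ^ (2 * m) ∉ Q0 := by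
    rintro m ⟨l, hl, h⟩
    refine ks_lemE (L := L) (Finset.univ : Finset (Fin l.length)) (fun i => (l.get i).1) (fun i _ => hl _ (List.get_mem _ _))
      _ p rfl a b hab (fun i => (l.get i).2) ?_
    rw [← AdjoinRoot.mk_eq_zero]
    rw [one_pow] at h
    have e : (l.map fun y => AdjoinRoot.mk p (C y.1 * (y.2 * y.2))).sum =
      ∑ i : Fin l.length, AdjoinRoot.mk p (C (l.get i).1 * ((l.get i).2 * (l.get i).2)) := by
      rw [← List.sum_ofFn]
      congr 1
      apply List.ext_get <;> simp
    rw [e] at h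
    rw [map_add, map_sum, map_one, ← h]; ring
  obtain ⟨Q, hQ0, hQ, hQn, hQt, hQp⟩ := ks_prime_cone (1 : AdjoinRoot p) Q0 hpre hneg
  refine ⟨Q, hQ, ?_, hQt, ?_⟩
  · intro c hc
    apply hQ0
    have := hcs c 1 hc
    simpa using this
  · intro x h1 h2
    by_contra hx
    apply hQn 0
    have := hQ.mul _ (hQ.mul _ h2 _ h1) _ (hQ.sq x⁻¹)
    have e : -x * x * (x⁻¹ * x⁻¹) = -1 ^ (2 * 0) := by field_simp; simp
    rwa [e] at this
end lemE

section fieldcone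

structure KSFC {F : Type} [Field F] (T : Set F) : Prop where
  one : (1 : F) ∈ T
  zero : (0 : F) ∈ T
  add : ∀ a ∈ T, ∀ b ∈ T, a + b ∈ T
  mul : ∀ a ∈ T, ∀ b ∈ T, a * b ∈ T
  inv : ∀ a ∈ T, a⁻¹ ∈ T
  anti : ∀ a, a ∈ T → -a ∈ T → a = 0
  tot : ∀ a ∈ T, ∀ b ∈ T, a - b ∈ T ∨ b - a ∈ T

variable {F : Type} [Field F]

def KSFC.sub {T : Set F} (h : KSFC T) : Subfield F where
  carrier := {x | x ∈ T ∨ -x ∈ T}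
  mul_mem' := by
    rintro a b (ha | ha) (hb | hb)
    · exact Or.inl (h.mul _ ha _ hb)
    · exact Or.inr (by simpa using h.mul _ ha _ hb)
    · exact Or.inr (by simpa using h.mul _ ha _ hb)
    · exact Or.inl (by simpa using h.mul _ ha _ hb)
  one_mem' := Or.inl h.one
  add_mem' := by
    rintro a b (ha | ha) (hb | hb)
    · exact Or.inl (h.add _ ha _ hb)
    · rcases h.tot _ ha _ hb with k | k
      · exact Or.inl (by simpa using k)
      · exact Or.inr (by have e : -(a + b) = -b - a := by ring
                         rw [e]; exact k)
    · rcases h.tot _ ha _ hb with k | k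
      · exact Or.inr (by have e : -(a + b) = -a - b := by ring
                         rw [e]; exact k)
      · exact Or.inl (by have e : a + b = b - -a := by ring
                         rw [e]; exact k)
    · exact Or.inr (by have e : -(a + b) = -a + -b := by ring
                       rw [e]; exact h.add _ ha _ hb)
  zero_mem' := Or.inl h.zero
  neg_mem' := by
    rintro a (ha | ha)
    · exact Or.inr (by simpa using ha)
    · exact Or.inl ha
  inv_mem' := by
    rintro a (ha | ha)
    · exact Or.inl (h.inv _ ha)
    · exact Or.inr (by have := h.inv _ ha; rwa [inv_neg] at this)

def KSFC.cone {T : Set F} (h : KSFC T) : RingCone h.sub where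
  carrier := {x | (x : F) ∈ T}
  mul_mem' := fun ha hb => h.mul _ ha _ hb
  one_mem' := h.one
  add_mem' := fun ha hb => h.add _ ha _ hb
  zero_mem' := h.zero
  eq_zero_of_mem_of_neg_mem' := fun {a} ha hb => Subtype.ext (h.anti _ ha hb)

theorem KSFC.cone_tot {T : Set F} (h : KSFC T) : HasMemOrNegMem h.cone where
  mem_or_neg_mem := fun a => a.2

theorem KSFC.order {T : Set F} (h : KSFC T) : ∃ (_ : LinearOrder h.sub) (_ : IsStrictOrderedRing h.sub),
    ∀ x : h.sub, 0 ≤ x ↔ (x : F) ∈ T := by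
  classical
  have := h.cone_tot
  let o : LinearOrder h.sub := LinearOrder.mkOfAddGroupCone h.cone
  have : IsOrderedRing h.sub := IsOrderedRing.mkOfCone h.cone
  refine ⟨o, inferInstance, fun x => ?_⟩
  show (x - 0 : h.sub) ∈ h.cone ↔ _
  rw [sub_zero]
  exact Iff.rfl

theorem ks_max_cone (T0 : Set F) (h0 : KSFC T0) : ∃ T, T0 ⊆ T ∧ KSFC T ∧ ∀ T', KSFC T' → T ⊆ T' → T' ⊆ T := by
  obtain ⟨M, hM0, hM⟩ := zorn_subset_nonempty {Q : Set F | KSFC Q}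
    (by
      intro c hc hch hne
      have two : ∀ a ∈ ⋃₀ c, ∀ b ∈ ⋃₀ c, ∃ s ∈ c, a ∈ s ∧ b ∈ s := by
        rintro a ⟨s, hs, ha⟩ b ⟨t, ht, hb⟩
        rcases hch.total hs ht with h | h
        · exact ⟨t, ht, h ha, hb⟩
        · exact ⟨s, hs, ha, h hb⟩
      refine ⟨⋃₀ c, ⟨?_, ?_, ?_, ?_, ?_, ?_, ?_⟩, fun s hs => Set.subset_sUnion_of_mem hs⟩
      · obtain ⟨s, hs⟩ := hne
        exact ⟨s, hs, (hc hs).one⟩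
      · obtain ⟨s, hs⟩ := hne
        exact ⟨s, hs, (hc hs).zero⟩
      · intro a ha b hb
        obtain ⟨s, hs, h1, h2⟩ := two a ha b hb
        exact ⟨s, hs, (hc hs).add _ h1 _ h2⟩
      · intro a ha b hb
        obtain ⟨s, hs, h1, h2⟩ := two a ha b hb
        exact ⟨s, hs, (hc hs).mul _ h1 _ h2⟩
      · rintro a ⟨s, hs, ha⟩
        exact ⟨s, hs, (hc hs).inv _ ha⟩
      · intro a ha hb
        obtain ⟨s, hs, h1, h2⟩ := two a ha _ hb
        exact (hc hs).anti _ h1 h2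
      · intro a ha b hb
        obtain ⟨s, hs, h1, h2⟩ := two a ha b hb
        exact ((hc hs).tot _ h1 _ h2).imp (fun h => ⟨s, hs, h⟩) (fun h => ⟨s, hs, h⟩)) T0 h0
  exact ⟨M, hM0, hM.prop, fun T' h1 h2 => hM.le_of_ge h1 h2⟩

theorem ks_image_cone {E : Type} [Field E] (j : E →+* F) (Q : Set E) (hQ : KSPre Q)
    (htot : ∀ x, x ∈ Q ∨ -x ∈ Q) (hanti : ∀ x, x ∈ Q → -x ∈ Q → x = 0) : KSFC (j '' Q) where
  one := ⟨1, hQ.one, map_one j⟩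
  zero := ⟨0, hQ.zero, map_zero j⟩
  add := by
    rintro _ ⟨a, ha, rfl⟩ _ ⟨b, hb, rfl⟩
    exact ⟨a + b, hQ.add _ ha _ hb, map_add _ _ _⟩
  mul := by
    rintro _ ⟨a, ha, rfl⟩ _ ⟨b, hb, rfl⟩
    exact ⟨a * b, hQ.mul _ ha _ hb, map_mul _ _ _⟩
  inv := by
    rintro _ ⟨a, ha, rfl⟩
    refine ⟨a⁻¹, ?_, map_inv₀ _ _⟩
    by_cases h : a = 0
    · simpa [h] using hQ.zero
    have := hQ.mul _ ha _ (hQ.sq a⁻¹)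
    rwa [mul_inv_cancel_left₀ h] at this
  anti := by
    rintro _ ⟨a, ha, rfl⟩ ⟨b, hb, hab⟩
    rw [← map_neg] at hab
    have := j.injective hab
    subst this
    rw [hanti a ha hb, map_zero]
  tot := by
    rintro _ ⟨a, ha, rfl⟩ _ ⟨b, hb, rfl⟩
    rcases htot (a - b) with h | h
    · exact Or.inl ⟨_, h, map_sub _ _ _⟩
    · exact Or.inr ⟨b - a, by simpa using h, map_sub _ _ _⟩

theorem ks_between {K : Type} [Field K] [LinearOrder K] [IsStrictOrderedRing K] (a b α c : K) (hab : a < b)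
    (hp0 : (a - α) * c * ((b - α) * c) < 0) : a < α ∧ α < b := by
  have key : (a - α) * (b - α) < 0 := by
    by_contra hcon
    push Not at hcon
    nlinarith [mul_nonneg hcon (mul_self_nonneg c)]
  refine ⟨?_, ?_⟩
  · by_contra hcon
    push Not at hcon
    nlinarith [mul_nonneg (sub_nonneg.2 hcon) (sub_nonneg.2 (hcon.trans hab.le))]
  · by_contra hcon
    push Not at hcon
    nlinarith [mul_nonneg (sub_nonneg.2 hcon) (sub_nonneg.2 (hab.le.trans hcon))]

theorem ks_real_closure [IsAlgClosed F] (T0 : Set F) (h0 : KSFC T0) :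
    ∃ (L : Subfield F) (_ : LinearOrder L) (_ : IsStrictOrderedRing L), KSIvt L ∧
      ∀ x ∈ T0, ∃ hx : x ∈ L, 0 ≤ (⟨x, hx⟩ : L) := by
  obtain ⟨T, hT0, hT, hmax⟩ := ks_max_cone T0 h0
  obtain ⟨o, hs, ho⟩ := hT.order
  refine ⟨hT.sub, o, hs, ?_, fun x hx => ⟨Or.inl (hT0 hx), (ho _).2 (hT0 hx)⟩⟩
  intro p a b hab hp
  obtain ⟨p0, hirr, hdvd, hp0⟩ := ks_irred_factor _ p rfl a b hp
  have : Fact (Irreducible p0) := ⟨hirr⟩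
  obtain ⟨Q, hQ, hQL, hQt, hQa⟩ := ks_adjoin_cone p0 a b hp0
  obtain ⟨z, hz⟩ := IsAlgClosed.exists_eval₂_eq_zero hT.sub.subtype p0 (degree_pos_of_irreducible hirr).ne'
  let j : AdjoinRoot p0 →+* F := AdjoinRoot.lift hT.sub.subtype z hz
  have hsub := hmax _ (ks_image_cone j Q hQ hQt hQa) (by
    intro x hx
    refine ⟨AdjoinRoot.of p0 ⟨x, Or.inl hx⟩, hQL _ ((ho _).2 hx), ?_⟩
    simp [j])
  have hzL : z ∈ hT.sub := by
    rcases hQt (AdjoinRoot.root p0) with h | h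
    · exact Or.inl (hsub ⟨_, h, by simp [j]⟩)
    · exact Or.inr (hsub ⟨_, h, by simp [j]⟩)
  let α : hT.sub := ⟨z, hzL⟩
  have hα : p0.eval α = 0 := by
    apply hT.sub.subtype.injective
    rw [map_zero, ← hz, ← eval₂_at_apply]
    rfl
  have hd := degree_eq_one_of_irreducible_of_root hirr hα
  obtain ⟨r, hr⟩ := dvd_iff_isRoot.2 hα
  have hr0 : r.natDegree = 0 := by
    have h1 : p0.natDegree = 1 := natDegree_eq_of_degree_eq_some hd
    have hrne : r ≠ 0 := by rintro rfl; rw [mul_zero] at hr; exact hirr.ne_zero hr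
    rw [hr, natDegree_mul (X_sub_C_ne_zero _) hrne, natDegree_X_sub_C] at h1
    omega
  rw [eq_C_of_natDegree_eq_zero hr0] at hr
  rw [hr] at hp0
  simp only [eval_mul, eval_sub, eval_X, eval_C] at hp0
  obtain ⟨c1, c2⟩ := ks_between a b α _ hab hp0
  exact ⟨α, c1, c2, eval_eq_zero_of_dvd_of_eval_eq_zero hdvd hα⟩

theorem ks_exists_field {A : Type} [CommRing A] (I : Ideal A) [I.IsPrime] :
    ∃ (F : Type) (_ : Field F) (_ : IsAlgClosed F) (φ : A →+* F), ∀ a, φ a = 0 ↔ a ∈ I := by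
  refine ⟨AlgebraicClosure (FractionRing (A ⧸ I)), inferInstance, inferInstance,
    (algebraMap (FractionRing (A ⧸ I)) _).comp
    ((algebraMap (A ⧸ I) (FractionRing (A ⧸ I))).comp (Ideal.Quotient.mk I)), fun a => ?_⟩
  rw [← Ideal.Quotient.eq_zero_iff_mem]
  simp only [RingHom.comp_apply]
  rw [map_eq_zero_iff _ (RingHom.injective _),
        map_eq_zero_iff _ (IsFractionRing.injective (A ⧸ I) (FractionRing (A ⧸ I)))]

/-- from a prime cone to an ordered field -/
theorem ks_cone_to_field {A : Type} [CommRing A] (Q : Set A) (hQ : KSPre Q) (hone : -(1 : A) ∉ Q)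
    (htot : ∀ a, a ∈ Q ∨ -a ∈ Q)
    (hpr : ∀ a b, a * b ∈ Q → -(a * b) ∈ Q → (a ∈ Q ∧ -a ∈ Q) ∨ (b ∈ Q ∧ -b ∈ Q)) :
    ∃ (R : Type) (_ : Field R) (_ : LinearOrder R) (_ : IsStrictOrderedRing R) (φ : A →+* R), KSIvt R ∧
      (∀ a ∈ Q, 0 ≤ φ a) ∧ (∀ a, φ a = 0 → a ∈ Q ∧ -a ∈ Q) := by
  let I : Ideal A :=
    { carrier := {a | a ∈ Q ∧ -a ∈ Q}
      add_mem' := by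
        rintro a b ⟨h1, h2⟩ ⟨h3, h4⟩
        refine ⟨hQ.add _ h1 _ h3, ?_⟩
        rw [neg_add]; exact hQ.add _ h2 _ h4
      zero_mem' := ⟨hQ.zero, by simpa using hQ.zero⟩
      smul_mem' := by
        rintro c a ⟨h1, h2⟩
        rw [smul_eq_mul]
        rcases htot c with h | h
        · exact ⟨hQ.mul _ h _ h1, by rw [← mul_neg]; exact hQ.mul _ h _ h2⟩
        · exact ⟨by rw [← neg_mul_neg]; exact hQ.mul _ h _ h2, by rw [← neg_mul]; exact hQ.mul _ h _ h1⟩ }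
  have hIp : I.IsPrime := ⟨by
      rw [Ideal.ne_top_iff_one]; exact fun h => hone h.2, fun {a b} h => hpr a b h.1 h.2⟩
  obtain ⟨F, _, _, φ, hφ0⟩ := ks_exists_field I
  have hφ : ∀ a, φ a = 0 ↔ a ∈ Q ∧ -a ∈ Q := fun a => hφ0 a
  have hmem : ∀ a ∈ Q, ∀ b, φ a = φ b → b ∈ Q := by
    intro a ha b hab
    have := (hφ (b - a)).1 (by rw [map_sub, hab, sub_self])
    have := hQ.add _ this.1 _ ha
    simpa using this
  let T : Set F := {x | ∃ a ∈ Q, ∃ b ∈ Q, φ b ≠ 0 ∧ x = φ a / φ b}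
  have hφ1 : φ 1 ≠ 0 := by simp
  have hT : KSFC T := by
    refine ⟨⟨1, hQ.one, 1, hQ.one, hφ1, by simp⟩, ⟨0, hQ.zero, 1, hQ.one, hφ1, by simp⟩, ?_, ?_, ?_, ?_, ?_⟩
    · rintro _ ⟨a, ha, b, hb, hb0, rfl⟩ _ ⟨c, hc, d, hd, hd0, rfl⟩
      refine ⟨a * d + b * c, hQ.add _ (hQ.mul _ ha _ hd) _ (hQ.mul _ hb _ hc), b * d, hQ.mul _ hb _ hd, ?_, ?_⟩
      · rw [map_mul]; exact mul_ne_zero hb0 hd0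
      · rw [map_add, map_mul, map_mul, map_mul, div_add_div _ _ hb0 hd0]
    · rintro _ ⟨a, ha, b, hb, hb0, rfl⟩ _ ⟨c, hc, d, hd, hd0, rfl⟩
      refine ⟨a * c, hQ.mul _ ha _ hc, b * d, hQ.mul _ hb _ hd, ?_, ?_⟩
      · rw [map_mul]; exact mul_ne_zero hb0 hd0
      · rw [map_mul, map_mul, div_mul_div_comm]
    · rintro _ ⟨a, ha, b, hb, hb0, rfl⟩
      by_cases h : φ a = 0
      · exact ⟨0, hQ.zero, 1, hQ.one, hφ1, by simp [h]⟩
      · exact ⟨b, hb, a, ha, h, by rw [inv_div]⟩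
    · rintro _ ⟨a, ha, b, hb, hb0, rfl⟩ ⟨c, hc, d, hd, hd0, h⟩
      have h1 : φ (a * d) = φ (-(b * c)) := by
        rw [← neg_div, div_eq_div_iff hb0 hd0] at h
        simp only [map_mul, map_neg]
        linear_combination -h
      have h2 := hmem _ (hQ.mul _ ha _ hd) _ h1
      have h3 : φ (b * c) = 0 := (hφ _).2 ⟨hQ.mul _ hb _ hc, h2⟩
      rw [map_neg, h3, neg_zero, map_mul] at h1
      rw [(mul_eq_zero.1 h1).resolve_right hd0, zero_div]
    · rintro _ ⟨a, ha, b, hb, hb0, rfl⟩ _ ⟨c, hc, d, hd, hd0, rfl⟩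
      rcases htot (a * d - b * c) with h | h
      · left
        refine ⟨_, h, b * d, hQ.mul _ hb _ hd, ?_, ?_⟩
        · rw [map_mul]; exact mul_ne_zero hb0 hd0
        · rw [map_sub, map_mul, map_mul, map_mul, div_sub_div _ _ hb0 hd0]
      · right
        refine ⟨_, h, b * d, hQ.mul _ hb _ hd, ?_, ?_⟩
        · rw [map_mul]; exact mul_ne_zero hb0 hd0
        · rw [map_neg, map_sub, map_mul, map_mul, map_mul, div_sub_div _ _ hd0 hb0]
          rw [div_eq_div_iff (mul_ne_zero hd0 hb0) (mul_ne_zero hb0 hd0)]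
          ring
  obtain ⟨L, o, hs, hivt, hL⟩ := ks_real_closure T hT
  have hφT : ∀ a ∈ Q, φ a ∈ T := fun a ha => ⟨a, ha, 1, hQ.one, hφ1, by simp⟩
  have hφL : ∀ a, φ a ∈ L := by
    intro a
    rcases htot a with h | h
    · exact (hL _ (hφT _ h)).1
    · have := (hL _ (hφT _ h)).1
      rw [map_neg] at this
      exact neg_mem_iff.1 this
  refine ⟨L, inferInstance, o, hs, φ.codRestrict L hφL, hivt, fun a ha => (hL _ (hφT _ ha)).2, fun a ha => ?_⟩
  exact (hφ a).1 (congrArg Subtype.val ha)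
end fieldcone

section final
variable {n r s : ℕ}

theorem ks_sos_zero : IsSOS (0 : MvPolynomial (Fin n) ℝ) := ⟨0, fun _ => 0, by simp⟩

theorem ks_sos_sq (p : MvPolynomial (Fin n) ℝ) : IsSOS (p ^ 2) := ⟨1, fun _ => p, by simp⟩

theorem ks_sos_add {a b : MvPolynomial (Fin n) ℝ} (ha : IsSOS a) (hb : IsSOS b) : IsSOS (a + b) := by
  obtain ⟨k, p, rfl⟩ := ha
  obtain ⟨l, p', rfl⟩ := hb
  exact ⟨k + l, Fin.append p p', by simp [Fin.sum_univ_add]⟩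

theorem ks_sos_sum {ι : Type} (I : Finset ι) (a : ι → MvPolynomial (Fin n) ℝ) (ha : ∀ i ∈ I, IsSOS (a i)) :
    IsSOS (∑ i ∈ I, a i) := by
  classical
  induction I using Finset.induction_on with
  | empty => simpa using ks_sos_zero
  | insert i I hi ih =>
    rw [Finset.sum_insert hi]
    exact ks_sos_add (ha _ (Finset.mem_insert_self _ _)) (ih fun j hj => ha j (Finset.mem_insert_of_mem hj))

theorem ks_sos_mul {a b : MvPolynomial (Fin n) ℝ} (ha : IsSOS a) (hb : IsSOS b) : IsSOS (a * b) := by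
  obtain ⟨k, p, rfl⟩ := ha
  obtain ⟨l, p', rfl⟩ := hb
  rw [Finset.sum_mul_sum]
  refine ks_sos_sum _ _ fun i _ => ks_sos_sum _ _ fun j _ => ?_
  rw [← mul_pow]
  exact ks_sos_sq _

variable (f : Fin r → MvPolynomial (Fin n) ℝ) (g : Fin s → MvPolynomial (Fin n) ℝ)

theorem ks_pre_zero : InPreorder f g 0 := ⟨fun _ => 0, fun _ => 0, fun _ => ks_sos_zero, by simp⟩

theorem ks_pre_add {a b : MvPolynomial (Fin n) ℝ} (ha : InPreorder f g a) (hb : InPreorder f g b) :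
    InPreorder f g (a + b) := by
  obtain ⟨σ, p, h, rfl⟩ := ha
  obtain ⟨σ', p', h', rfl⟩ := hb
  refine ⟨fun ε => σ ε + σ' ε, fun j => p j + p' j, fun ε => ks_sos_add (h ε) (h' ε), ?_⟩
  simp only [add_mul, Finset.sum_add_distrib]
  ring

theorem ks_pre_sum {ι : Type} (I : Finset ι) (a : ι → MvPolynomial (Fin n) ℝ) (ha : ∀ i ∈ I, InPreorder f g (a i)) :
    InPreorder f g (∑ i ∈ I, a i) := by
  classical
  induction I using Finset.induction_on with
  | empty => simpa using ks_pre_zero f g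
  | insert i I hi ih =>
    rw [Finset.sum_insert hi]
    exact ks_pre_add f g (ha _ (Finset.mem_insert_self _ _)) (ih fun j hj => ha j (Finset.mem_insert_of_mem hj))

theorem ks_pre_ideal (c : MvPolynomial (Fin n) ℝ) (j : Fin s) : InPreorder f g (c * g j) := by
  classical
  refine ⟨fun _ => 0, fun i => if i = j then c else 0, fun _ => ks_sos_zero, ?_⟩
  simp

theorem ks_pre_term (c : MvPolynomial (Fin n) ℝ) (hc : IsSOS c) (ε : Fin r → Bool) :
    InPreorder f g (c * ∏ i, if ε i then f i else 1) := by
  classical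
  refine ⟨fun e => if e = ε then c else 0, fun _ => 0, ?_, ?_⟩
  · intro e
    by_cases h : e = ε
    · simpa [h] using hc
    · simpa [h] using ks_sos_zero
  · simp

theorem ks_pre_term_mul (c d : MvPolynomial (Fin n) ℝ) (hc : IsSOS c) (hd : IsSOS d) (ε δ : Fin r → Bool) :
    InPreorder f g ((c * ∏ i, if ε i then f i else 1) * (d * ∏ i, if δ i then f i else 1)) := by
  have e : (c * ∏ i, if ε i then f i else 1) * (d * ∏ i, if δ i then f i else 1)
      = (c * d * (∏ i, if ε i && δ i then f i else 1) ^ 2) * ∏ i, if xor (ε i) (δ i) then f i else 1 := by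
    have : (∏ i, if ε i then f i else 1) * (∏ i, if δ i then f i else 1)
      = (∏ i, if ε i && δ i then f i else 1) ^ 2 * ∏ i, if xor (ε i) (δ i) then f i else 1 := by
      rw [← Finset.prod_mul_distrib, ← Finset.prod_pow, ← Finset.prod_mul_distrib]
      refine Finset.prod_congr rfl fun i _ => ?_
      cases ε i <;> cases δ i <;> simp [sq]
    linear_combination c * d * this
  rw [e]
  exact ks_pre_term f g _ (ks_sos_mul (ks_sos_mul hc hd) (ks_sos_sq _)) (fun i => xor (ε i) (δ i))

theorem ks_pre_mul {a b : MvPolynomial (Fin n) ℝ} (ha : InPreorder f g a) (hb : InPreorder f g b) :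
    InPreorder f g (a * b) := by
  obtain ⟨σ, p, h, rfl⟩ := ha
  obtain ⟨σ', p', h', rfl⟩ := hb
  rw [add_mul, mul_add, add_assoc]
  refine ks_pre_add f g ?_ (ks_pre_add f g ?_ ?_)
  · rw [Finset.sum_mul_sum]
    exact ks_pre_sum f g _ _ fun ε _ => ks_pre_sum f g _ _ fun δ _ => ks_pre_term_mul f g _ _ (h ε) (h' δ) ε δ
  · rw [Finset.mul_sum]
    refine ks_pre_sum f g _ _ fun j _ => ?_
    rw [← mul_assoc]
    exact ks_pre_ideal f g _ j
  · rw [Finset.sum_mul]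
    refine ks_pre_sum f g _ _ fun j _ => ?_
    rw [mul_right_comm]
    exact ks_pre_ideal f g _ j

theorem ks_pre_sq (a : MvPolynomial (Fin n) ℝ) : InPreorder f g (a * a) := by
  have := ks_pre_term f g _ (ks_sos_sq a) (fun _ => false)
  simpa [sq] using this

theorem ks_pre_f (i : Fin r) : InPreorder f g (f i) := by
  classical
  have := ks_pre_term f g _ (ks_sos_sq 1) (fun j => decide (j = i))
  simpa using this

theorem ks_pre_pre : KSPre {a | InPreorder f g a} :=
  ⟨fun _ ha _ hb => ks_pre_add f g ha hb, fun _ ha _ hb => ks_pre_mul f g ha hb, fun a => ks_pre_sq f g a⟩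

theorem ks_pre_eval {q : MvPolynomial (Fin n) ℝ} (hq : InPreorder f g q) (x : Fin n → ℝ)
    (hf : ∀ i, 0 ≤ MvPolynomial.eval x (f i)) (hg : ∀ j, MvPolynomial.eval x (g j) = 0) :
    0 ≤ MvPolynomial.eval x q := by
  obtain ⟨σ, p, h, rfl⟩ := hq
  simp only [map_add, map_sum, map_mul, map_prod, hg, mul_zero, Finset.sum_const_zero, add_zero]
  refine Finset.sum_nonneg fun ε _ => mul_nonneg ?_ (Finset.prod_nonneg fun i _ => ?_)
  · obtain ⟨k, u, hu⟩ := h ε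
    rw [hu]
    simp only [map_sum, map_pow]
    exact Finset.sum_nonneg fun i _ => sq_nonneg _
  · split_ifs
    · exact hf i
    · simp

theorem ks_hard (q : MvPolynomial (Fin n) ℝ)
    (hK : ∀ x : Fin n → ℝ, ((∀ i : Fin r, 0 ≤ MvPolynomial.eval x (f i)) ∧
          (∀ j : Fin s, MvPolynomial.eval x (g j) = 0)) → 0 ≤ MvPolynomial.eval x q) :
    ∃ (m : ℕ) (h₁ h₂ : MvPolynomial (Fin n) ℝ),
        InPreorder f g h₁ ∧ InPreorder f g h₂ ∧ h₁ * q = q ^ (2 * m) + h₂ := by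
  classical
  by_contra hcon
  push Not at hcon
  have hP := ks_pre_pre f g
  obtain ⟨Q, hQ0, hQ, hQn, hQt, hQp⟩ := ks_prime_cone q _ (hP.ext (-q)) (by
    rintro m ⟨a, ha, b, hb, h⟩
    exact hcon m b a hb ha (by linear_combination h))
  have hPQ : ∀ a, InPreorder f g a → a ∈ Q := fun a ha => hQ0 ⟨a, ha, 0, hP.zero, by ring⟩
  have hqQ : -q ∈ Q := hQ0 ⟨0, hP.zero, 1, hP.one, by ring⟩
  obtain ⟨R, _, _, _, φ, hR, h1, h2⟩ := ks_cone_to_field Q hQ (by simpa using hQn 0) hQt hQp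
  obtain ⟨x, hx⟩ := ks_transfer hR n φ (Finset.univ.image f ∪ Finset.univ.image g ∪ {q})
  have hq0 : φ q < 0 := by
    refine lt_of_le_of_ne (by simpa using h1 _ hqQ) fun h => ?_
    have := h2 _ h
    apply hQn 1
    have := hQ.mul _ this.1 _ this.2
    simpa [sq] using this
  have hxq : MvPolynomial.eval x q < 0 := by
    have := hx q (by simp)
    rw [sign_neg hq0] at this
    exact sign_eq_neg_one_iff.1 this
  refine absurd (hK x ⟨fun i => ?_, fun j => ?_⟩) (not_le.2 hxq)
  · have := hx (f i) (by simp)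
    rw [← sign_nonneg_iff, this, sign_nonneg_iff]
    exact h1 _ (hPQ _ (ks_pre_f f g i))
  · have := hx (g j) (by simp)
    rw [← sign_eq_zero_iff, this, sign_eq_zero_iff]
    have a1 := h1 _ (hPQ _ (ks_pre_ideal f g 1 j))
    have a2 := h1 _ (hPQ _ (ks_pre_ideal f g (-1) j))
    simp at a1 a2
    exact le_antisymm a2 a1
end final

end kshelpers

/-- Krivine–Stengle Positivstellensatz (nonnegativity form): `q ≥ 0` on
`K = {x : fᵢ(x) ≥ 0, gⱼ(x) = 0}` iff `h₁ q = q^{2m} + h₂` for some `m ≥ 0` and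
`h₁, h₂` in the preorder. -/
theorem ks_positivstellensatz_nonneg {n r s : ℕ}
    (f : Fin r → MvPolynomial (Fin n) ℝ) (g : Fin s → MvPolynomial (Fin n) ℝ)
    (q : MvPolynomial (Fin n) ℝ) :
    (∀ x : Fin n → ℝ,
        ((∀ i : Fin r, 0 ≤ MvPolynomial.eval x (f i)) ∧
          (∀ j : Fin s, MvPolynomial.eval x (g j) = 0)) →
        0 ≤ MvPolynomial.eval x q) ↔
      ∃ (m : ℕ) (h₁ h₂ : MvPolynomial (Fin n) ℝ),
        InPreorder f g h₁ ∧ InPreorder f g h₂ ∧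
        h₁ * q = q ^ (2 * m) + h₂ := by
  refine ⟨ks_hard f g q, ?_⟩
  rintro ⟨m, h₁, h₂, hh1, hh2, h⟩ x ⟨hf, hg⟩
  have e1 := ks_pre_eval f g hh1 x hf hg
  have e2 := ks_pre_eval f g hh2 x hf hg
  have e := congrArg (MvPolynomial.eval x) h
  simp only [map_mul, map_add, map_pow] at e
  by_contra hlt
  push Not at hlt
  have h3 : 0 < (MvPolynomial.eval x q) ^ (2 * m) := by
    rw [pow_mul]; exact pow_pos (sq_pos_of_neg hlt) m
  nlinarith [mul_nonneg e1 (neg_nonneg.2 hlt.le)]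
end
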